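/- arXiv:2107.00515 — 2 statements merged into one kernel-verified Lean document; each statement's English description precedes it below -/
import Mathlib

section
/- A subset R ⊂ H^n of finite spherical Hausdorff measure S^{Q-m}(R) < ∞ is H-rectifiable of codimension m ≤ n if and only if for every ε > 0 there exists a single C¹_H submanifold S ⊂ H^n of codimension m such that S^{Q-m}(R \ S) < ε. -/
open Filter Topology
open scoped BigOperators ENNReal

/-- The Heisenberg group `ℍⁿ`, of homogeneous dimension `Q = 2n+2`. -/
abbrev Heis (n : ℕ) := (Fin n → ℝ) × (Fin n → ℝ) × ℝ

noncomputable def Heis.mul {n : ℕ} (p q : Heis n) : Heis n :=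
  (p.1 + q.1, p.2.1 + q.2.1,
    p.2.2 + q.2.2 + (1 / 2) * ∑ j, (p.1 j * q.2.1 j - q.1 j * p.2.1 j))

noncomputable def Heis.inv {n : ℕ} (p : Heis n) : Heis n := (-p.1, -p.2.1, -p.2.2)

noncomputable def Heis.dil {n : ℕ} (lam : ℝ) (p : Heis n) : Heis n :=
  (lam • p.1, lam • p.2.1, lam ^ 2 * p.2.2)

/-- `d` is a left-invariant homogeneous distance on `ℍⁿ`. -/
structure IsHomDist (n : ℕ) (d : Heis n → Heis n → ℝ) : Prop where
  eq_iff : ∀ p q, d p q = 0 ↔ p = q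
  symm : ∀ p q, d p q = d q p
  triangle : ∀ p q r, d p r ≤ d p q + d q r
  leftInv : ∀ p' p q, d (Heis.mul p' p) (Heis.mul p' q) = d p q
  homog : ∀ lam : ℝ, 0 < lam → ∀ p q, d (Heis.dil lam p) (Heis.dil lam q) = lam * d p q

/-- The horizontal pairing `v · q_H`. -/
noncomputable def Heis.hdot {n : ℕ} (v : (Fin n → ℝ) × (Fin n → ℝ)) (q : Heis n) : ℝ :=
  ∑ i, v.1 i * q.1 i + ∑ i, v.2 i * q.2.1 i

/-- The filter of convergence `q → p`, `q ∈ S`, `q ≠ p`, with respect to `d`. -/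
noncomputable def dnhds {n : ℕ} (d : Heis n → Heis n → ℝ) (S : Set (Heis n)) (p : Heis n) :
    Filter (Heis n) :=
  ⨅ (ε : ℝ) (_ : 0 < ε), Filter.principal {q | q ∈ S ∧ q ≠ p ∧ d p q < ε}

/-- A set which is open for the distance `d`. -/
def IsDOpen {n : ℕ} (d : Heis n → Heis n → ℝ) (U : Set (Heis n)) : Prop :=
  ∀ p ∈ U, ∃ ε : ℝ, 0 < ε ∧ {q | d p q < ε} ⊆ U

/-- `S` is a `C¹_ℍ` (ℍ-regular) submanifold of codimension `m`: locally the zero set of a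
continuously Pansu-differentiable `f : ℍⁿ → ℝᵐ` whose horizontal gradient has rank `m`. -/
def IsC1H {n : ℕ} (d : Heis n → Heis n → ℝ) (m : ℕ) (S : Set (Heis n)) : Prop :=
  ∀ p ∈ S, ∃ U : Set (Heis n), IsDOpen d U ∧ p ∈ U ∧
    ∃ f : Heis n → Fin m → ℝ, ∃ g : Heis n → Fin m → (Fin n → ℝ) × (Fin n → ℝ),
      (∀ q ∈ U, Tendsto f (dnhds d U q) (𝓝 (f q))) ∧
      (∀ q ∈ U, Tendsto g (dnhds d U q) (𝓝 (g q))) ∧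
      (S ∩ U = {q | q ∈ U ∧ f q = 0}) ∧
      (∀ q ∈ U, Tendsto
        (fun q' => ‖(fun i => f q' i - f q i - Heis.hdot (g q i) (Heis.mul (Heis.inv q) q') :
            Fin m → ℝ)‖ / d q q')
        (dnhds d Set.univ q) (𝓝 0)) ∧
      (∀ q ∈ U, LinearIndependent ℝ (g q))

/-- The spherical Hausdorff measure `S^s` associated with the distance `d` (as a set
function): infimum over countable coverings by `d`-balls of radii at most `δ`, then
supremum over `δ > 0`. -/
noncomputable def sphOuter {n : ℕ} (d : Heis n → Heis n → ℝ) (s : ℝ) (A : Set (Heis n)) :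
    ℝ≥0∞ :=
  ⨆ (δ : ℝ) (_ : 0 < δ),
    ⨅ (c : ℕ → Heis n) (r : ℕ → ℝ) (_ : ∀ i, 0 < r i ∧ r i ≤ δ)
      (_ : A ⊆ ⋃ i, {q | d (c i) q ≤ r i}),
      ∑' i, ENNReal.ofReal ((2 * r i) ^ s)

open MeasureTheory in
/-- Gauge of a set: infimum of `(2r)^s` over closed balls of radius `r ≤ δ` containing it. -/
noncomputable def sphGauge {X : Type*} [MetricSpace X] (s δ : ℝ) (A : Set X) : ℝ≥0∞ :=
  ⨅ (c : X) (r : ℝ) (_ : 0 < r ∧ r ≤ δ) (_ : A ⊆ {q | dist c q ≤ r}),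
    ENNReal.ofReal ((2 * r) ^ s)

/-- The size-`δ` premeasure of the spherical measure. -/
noncomputable def sphPre {X : Type*} [MetricSpace X] (s δ : ℝ) (A : Set X) : ℝ≥0∞ :=
  ⨅ (c : ℕ → X) (r : ℕ → ℝ) (_ : ∀ i, 0 < r i ∧ r i ≤ δ)
      (_ : A ⊆ ⋃ i, {q | dist (c i) q ≤ r i}),
      ∑' i, ENNReal.ofReal ((2 * r i) ^ s)

lemma small_radius {s δ : ℝ} (hs : 0 < s) (hδ : 0 < δ) {e : ℝ≥0∞} (he : 0 < e) :
    ∃ r : ℝ, (0 < r ∧ r ≤ δ) ∧ ENNReal.ofReal ((2 * r) ^ s) ≤ e := by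
  have h1 : Tendsto (fun r : ℝ => ENNReal.ofReal ((2 * r) ^ s)) (𝓝[>] 0) (𝓝 0) := by
    have h2 : Tendsto (fun r : ℝ => ENNReal.ofReal ((2 * r) ^ s)) (𝓝 0)
        (𝓝 (ENNReal.ofReal ((2 * (0 : ℝ)) ^ s))) := by
      apply (ENNReal.continuous_ofReal.tendsto _).comp
      have h3 : Continuous (fun r : ℝ => (2 * r) ^ s) :=
        (Real.continuous_rpow_const hs.le).comp (continuous_const.mul continuous_id)
      exact h3.tendsto 0
    simp only [mul_zero, Real.zero_rpow hs.ne', ENNReal.ofReal_zero] at h2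
    exact h2.mono_left nhdsWithin_le_nhds
  have h4 := ((tendsto_order.1 h1).2 e he).and (Ioo_mem_nhdsGT hδ)
  obtain ⟨r, hr, hr2⟩ := h4.exists
  exact ⟨r, ⟨hr2.1, hr2.2.le⟩, hr.le⟩

lemma sphPre_eq {X : Type*} [MetricSpace X] [Nonempty X] {s δ : ℝ} (hs : 0 < s) (hδ : 0 < δ)
    (A : Set X) : MeasureTheory.OuterMeasure.boundedBy (sphGauge s δ) A = sphPre s δ A := by
  apply le_antisymm
  · refine le_iInf fun c => le_iInf fun r => le_iInf fun hr => le_iInf fun hA => ?_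
    refine (MeasureTheory.measure_mono hA).trans ((MeasureTheory.measure_iUnion_le _).trans ?_)
    refine ENNReal.tsum_le_tsum fun i => ?_
    refine (MeasureTheory.OuterMeasure.boundedBy_le _).trans ?_
    exact iInf_le_of_le (c i) (iInf_le_of_le (r i) (iInf_le_of_le (hr i)
      (iInf_le_of_le subset_rfl le_rfl)))
  · rw [MeasureTheory.OuterMeasure.boundedBy_apply]
    refine le_iInf fun t => le_iInf fun ht => ?_
    refine ENNReal.le_of_forall_pos_le_add fun e he hlt => ?_
    obtain ⟨e', he', hsum⟩ := ENNReal.exists_pos_sum_of_countable'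
      (ENNReal.coe_pos.2 he).ne' ℕ
    have key : ∀ i, ∃ c : X, ∃ r : ℝ, (0 < r ∧ r ≤ δ) ∧ t i ⊆ {q | dist c q ≤ r} ∧
        ENNReal.ofReal ((2 * r) ^ s) ≤ (⨆ _ : (t i).Nonempty, sphGauge s δ (t i)) + e' i := by
      intro i
      rcases (t i).eq_empty_or_nonempty with h | h
      · obtain ⟨r, hr, hr2⟩ := small_radius hs hδ (he' i)
        exact ⟨Classical.arbitrary X, r, hr, by simp [h], hr2.trans le_add_self⟩
      · have hle : sphGauge s δ (t i) ≤ (⨆ _ : (t i).Nonempty, sphGauge s δ (t i)) :=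
          le_iSup (fun _ : (t i).Nonempty => sphGauge s δ (t i)) h
        have hfin : sphGauge s δ (t i) ≠ ⊤ :=
          ((hle.trans (ENNReal.le_tsum i)).trans_lt hlt).ne
        have h2 : sphGauge s δ (t i) < sphGauge s δ (t i) + e' i :=
          ENNReal.lt_add_right hfin (he' i).ne'
        have h3 := h2
        conv_lhs at h3 => rw [sphGauge]
        simp only [iInf_lt_iff] at h3
        obtain ⟨c, r, hr, hsub, h4⟩ := h3
        exact ⟨c, r, hr, hsub, h4.le.trans (by gcongr)⟩
    choose c r hr hsub hle using key
    have : sphPre s δ A ≤ ∑' i, ENNReal.ofReal ((2 * r i) ^ s) :=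
      iInf_le_of_le c (iInf_le_of_le r (iInf_le_of_le hr
        (iInf_le_of_le (ht.trans (Set.iUnion_mono hsub)) le_rfl)))
    refine this.trans ((ENNReal.tsum_le_tsum hle).trans ?_)
    rw [ENNReal.tsum_add]
    gcongr

/-- The spherical outer measure. -/
noncomputable def sphMeas (X : Type*) [MetricSpace X] (s : ℝ) : MeasureTheory.OuterMeasure X :=
  ⨆ (δ : ℝ) (_ : 0 < δ), MeasureTheory.OuterMeasure.boundedBy (sphGauge s δ)

lemma sphMeas_apply {X : Type*} [MetricSpace X] [Nonempty X] {s : ℝ} (hs : 0 < s) (A : Set X) :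
    sphMeas X s A = ⨆ (δ : ℝ) (_ : 0 < δ), sphPre s δ A := by
  simp only [sphMeas, MeasureTheory.OuterMeasure.iSup_apply]
  refine iSup_congr fun δ => iSup_congr fun hδ => ?_
  rw [sphPre_eq hs hδ]

lemma sphGauge_anti {X : Type*} [MetricSpace X] {s δ δ' : ℝ} (h : δ ≤ δ') (A : Set X) :
    sphGauge s δ' A ≤ sphGauge s δ A :=
  iInf_mono fun _ => iInf_mono fun _ => le_iInf fun hr =>
    iInf_le_of_le ⟨hr.1, hr.2.trans h⟩ le_rfl

lemma boundedBy_anti {X : Type*} [MetricSpace X] {s δ δ' : ℝ} (h : δ ≤ δ') (A : Set X) :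
    MeasureTheory.OuterMeasure.boundedBy (sphGauge s δ') A
      ≤ MeasureTheory.OuterMeasure.boundedBy (sphGauge s δ) A := by
  have : MeasureTheory.OuterMeasure.boundedBy (sphGauge (X := X) s δ')
      ≤ MeasureTheory.OuterMeasure.boundedBy (sphGauge s δ) :=
    MeasureTheory.OuterMeasure.le_boundedBy.2 fun t =>
      (MeasureTheory.OuterMeasure.boundedBy_le t).trans (sphGauge_anti h t)
  exact this A

lemma sphMeas_isMetric (X : Type*) [MetricSpace X] (s : ℝ) : (sphMeas X s).IsMetric := by
  rintro A B ⟨r, r0, hr⟩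
  refine le_antisymm (MeasureTheory.measure_union_le A B) ?_
  obtain ⟨ρ, hρ0, hρr⟩ : ∃ ρ : ℝ, 0 < ρ ∧ ENNReal.ofReal ρ ≤ r := by
    by_cases h : r = ⊤
    · exact ⟨1, one_pos, by simp [h]⟩
    · exact ⟨r.toReal, ENNReal.toReal_pos r0 h, ENNReal.ofReal_toReal_le⟩
  simp only [sphMeas, MeasureTheory.OuterMeasure.iSup_apply]
  refine ENNReal.biSup_add_biSup_le' (p := fun δ : ℝ => 0 < δ) (q := fun δ : ℝ => 0 < δ)
    ⟨1, one_pos⟩ ⟨1, one_pos⟩ fun δ1 h1 δ2 h2 => ?_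
  set δ := min (min δ1 δ2) (ρ / 3) with hδ
  have hδ0 : 0 < δ := lt_min (lt_min h1 h2) (by positivity)
  have hA := boundedBy_anti (s := s) (show δ ≤ δ1 from (min_le_left _ _).trans (min_le_left _ _)) A
  have hB := boundedBy_anti (s := s) (show δ ≤ δ2 from (min_le_left _ _).trans (min_le_right _ _)) B
  refine (add_le_add hA hB).trans ?_
  rw [← MeasureTheory.OuterMeasure.boundedBy_union_of_top_of_nonempty_inter]
  · exact le_iSup₂ (f := fun (δ : ℝ) (_ : 0 < δ) =>
      MeasureTheory.OuterMeasure.boundedBy (sphGauge s δ) (A ∪ B)) δ hδ0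
  · rintro u ⟨x, hxA, hxu⟩ ⟨y, hyB, hyu⟩
    simp only [sphGauge, iInf_eq_top]
    intro c t ht hu
    exfalso
    have hx : dist c x ≤ t := hu hxu
    have hy : dist c y ≤ t := hu hyu
    have h3 : ENNReal.ofReal ρ ≤ ENNReal.ofReal (dist x y) := by
      rw [← edist_dist]; exact hρr.trans (hr x hxA y hyB)
    rw [ENNReal.ofReal_le_ofReal_iff dist_nonneg] at h3
    have h4 := dist_triangle_left x y c
    have h5 : δ ≤ ρ / 3 := min_le_right _ _
    linarith [ht.2]

open MeasureTheory in
lemma key_lemma {X : Type*} [MetricSpace X] (μ : OuterMeasure X) (hμ : μ.IsMetric)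
    (R : Set X) (hR : μ R < ⊤) (S : ℕ → Set X)
    (hS : ∀ i, ∃ W, IsOpen W ∧ S i ⊆ W ∧ IsOpen (W \ S i))
    (h0 : μ (R \ ⋃ i, S i) = 0) {ε : ℝ≥0∞} (hε : 0 < ε) :
    ∃ V : ℕ → Set X, (∀ i, IsOpen (V i)) ∧ (∀ i j, i ≠ j → Disjoint (V i) (V j)) ∧
      μ (R \ ⋃ i, (S i ∩ V i)) < ε := by
  letI : MeasurableSpace X := borel X
  haveI : BorelSpace X := ⟨rfl⟩
  have hm : (OuterMeasure.restrict R μ).IsMetric := by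
    intro A B hAB
    simp only [OuterMeasure.restrict_apply, Set.union_inter_distrib_right]
    exact hμ _ _ (hAB.mono Set.inter_subset_left Set.inter_subset_left)
  set ν : Measure X := (OuterMeasure.restrict R μ).toMeasure hm.borel_le_caratheodory with hν
  have hνa : ∀ A, MeasurableSet A → ν A = μ (A ∩ R) := fun A hA => by
    rw [hν, toMeasure_apply _ _ hA, OuterMeasure.restrict_apply]
  haveI : IsFiniteMeasure ν := ⟨by rw [hνa _ MeasurableSet.univ]; simpa using hR⟩
  have hSm : ∀ i, MeasurableSet (S i) := fun i => by
    obtain ⟨W, hW, hSW, hWS⟩ := hS i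
    have : S i = W \ (W \ S i) := by simp [Set.inter_eq_right.2 hSW]
    rw [this]
    exact hW.measurableSet.diff hWS.measurableSet
  have hDm : ∀ i, MeasurableSet (disjointed S i) := MeasurableSet.disjointed hSm
  have hdis := disjoint_disjointed S
  obtain ⟨e, he, hsum⟩ := ENNReal.exists_pos_sum_of_countable' (ENNReal.half_pos hε.ne').ne' ℕ
  have hC : ∀ i, ∃ C, C ⊆ disjointed S i ∧ IsClosed C ∧ ν (disjointed S i \ C) < e i :=
    fun i => (hDm i).exists_isClosed_sdiff_lt (measure_ne_top _ _) (he i).ne'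
  choose C hCs hCc hCe using hC
  have htail := tendsto_measure_biUnion_Ici_zero_of_pairwise_disjoint (μ := ν)
    (fun i => (hDm i).nullMeasurableSet) hdis
  obtain ⟨N, hN⟩ := ((tendsto_order.1 htail).2 _ (ENNReal.half_pos hε.ne')).exists
  refine ⟨fun i => {x | i < N ∧ ∀ j ∈ Finset.range N, j ≠ i →
    Metric.infEDist x (C i) < Metric.infEDist x (C j)}, ?_, ?_, ?_⟩
  · intro i
    by_cases hi : i < N
    · simp only [hi, true_and]
      have : {x | ∀ j ∈ Finset.range N, j ≠ i →
          Metric.infEDist x (C i) < Metric.infEDist x (C j)} =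
        ⋂ j ∈ Finset.range N, {x | j ≠ i →
          Metric.infEDist x (C i) < Metric.infEDist x (C j)} := by
        ext x; simp
      rw [this]
      refine isOpen_biInter_finset fun j _ => ?_
      by_cases hj : j = i
      · simp [hj]
      · simp only [ne_eq, hj, not_false_eq_true, true_imp_iff]
        exact isOpen_lt Metric.continuous_infEDist Metric.continuous_infEDist
    · simp [hi]
  · intro i j hij
    rw [Set.disjoint_left]
    rintro x ⟨hi, hxi⟩ ⟨hj, hxj⟩
    exact lt_asymm (hxi j (Finset.mem_range.2 hj) hij.symm) (hxj i (Finset.mem_range.2 hi) hij)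
  · set T : Set X := (⋃ i, S i)ᶜ ∪ ((⋃ i ∈ Set.Ici N, disjointed S i) ∪
      ⋃ i, (disjointed S i \ C i)) with hT
    have hTm : MeasurableSet T :=
      (MeasurableSet.iUnion hSm).compl.union ((MeasurableSet.biUnion (Set.to_countable _)
        fun i _ => hDm i).union (MeasurableSet.iUnion fun i => (hDm i).diff (hCc i).measurableSet))
    have hsub : R \ ⋃ i, (S i ∩ {x | i < N ∧ ∀ j ∈ Finset.range N, j ≠ i →
        Metric.infEDist x (C i) < Metric.infEDist x (C j)}) ⊆ T ∩ R := by
      rintro x ⟨hxR, hx⟩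
      refine ⟨?_, hxR⟩
      by_contra hxT
      simp only [hT, Set.mem_union, not_or, Set.mem_compl_iff, not_not] at hxT
      obtain ⟨h1, h2, h3⟩ := hxT
      rw [← iUnion_disjointed] at h1
      obtain ⟨i, hi⟩ := Set.mem_iUnion.1 h1
      have hiN : i < N := by
        by_contra hcon
        exact h2 (Set.mem_biUnion (show i ∈ Set.Ici N from not_lt.1 hcon) hi)
      have hiC : x ∈ C i := by
        by_contra hcon
        exact h3 (Set.mem_iUnion.2 ⟨i, hi, hcon⟩)
      refine hx (Set.mem_iUnion.2 ⟨i, disjointed_subset S i hi, hiN, fun j _ hji => ?_⟩)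
      rw [(Metric.mem_iff_infEDist_zero_of_closed (hCc i)).1 hiC, pos_iff_ne_zero]
      intro hz
      have hxj := (Metric.mem_iff_infEDist_zero_of_closed (hCc j)).2 hz
      exact Set.disjoint_left.1 (hdis hji) (hCs j hxj) hi
    have hz : ν (⋃ i, S i)ᶜ = 0 := by
      rw [hνa _ (MeasurableSet.iUnion hSm).compl, Set.inter_comm, ← Set.sdiff_eq]
      exact h0
    calc _ ≤ μ (T ∩ R) := measure_mono hsub
      _ = ν T := (hνa T hTm).symm
      _ ≤ ν (⋃ i, S i)ᶜ + (ν (⋃ i ∈ Set.Ici N, disjointed S i) +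
          ν (⋃ i, (disjointed S i \ C i))) :=
        (measure_union_le _ _).trans (add_le_add le_rfl (measure_union_le _ _))
      _ ≤ 0 + (ν (⋃ i ∈ Set.Ici N, disjointed S i) + ∑' i, e i) := by
        rw [hz]
        gcongr
        exact (measure_iUnion_le _).trans (ENNReal.tsum_le_tsum fun i => (hCe i).le)
      _ < ε := by
        rw [zero_add, ← ENNReal.add_halves ε]
        exact ENNReal.add_lt_add hN hsum

lemma IsHomDist.nonneg {n : ℕ} {d : Heis n → Heis n → ℝ} (hd : IsHomDist n d) (p q : Heis n) :
    0 ≤ d p q := by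
  have h := hd.triangle p q p
  rw [(hd.eq_iff p p).2 rfl, hd.symm q p] at h
  linarith

/-- The metric space structure of a homogeneous distance. -/
noncomputable abbrev homMetric {n : ℕ} {d : Heis n → Heis n → ℝ} (hd : IsHomDist n d) :
    MetricSpace (Heis n) where
  dist := d
  dist_self p := (hd.eq_iff p p).2 rfl
  dist_comm := hd.symm
  dist_triangle := hd.triangle
  eq_of_dist_eq_zero h := (hd.eq_iff _ _).1 h

lemma isOpen_iff_isDOpen {n : ℕ} {d : Heis n → Heis n → ℝ} (hd : IsHomDist n d)
    (U : Set (Heis n)) :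
    @IsOpen _ (homMetric hd).toPseudoMetricSpace.toUniformSpace.toTopologicalSpace U
      ↔ IsDOpen d U := by
  rw [@Metric.isOpen_iff _ (homMetric hd).toPseudoMetricSpace]
  refine forall₂_congr fun p _ => exists_congr fun ε => and_congr Iff.rfl ?_
  have : @Metric.ball _ (homMetric hd).toPseudoMetricSpace p ε = {q | d p q < ε} := by
    ext q
    show d q p < ε ↔ d p q < ε
    rw [hd.symm]
  rw [this]

lemma dnhds_mono {n : ℕ} (d : Heis n → Heis n → ℝ) {S T : Set (Heis n)} (h : S ⊆ T) (p : Heis n) :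
    dnhds d S p ≤ dnhds d T p :=
  iInf₂_mono fun _ _ => Filter.principal_mono.2 fun _ hq => ⟨h hq.1, hq.2⟩

lemma mem_dnhds {n : ℕ} {d : Heis n → Heis n → ℝ} {S : Set (Heis n)} {p : Heis n}
    {t : Set (Heis n)} (h : t ∈ dnhds d S p) :
    ∃ ε : ℝ, 0 < ε ∧ {q | q ∈ S ∧ q ≠ p ∧ d p q < ε} ⊆ t := by
  have h' : t ∈ ⨅ ε ∈ Set.Ioi (0 : ℝ), 𝓟 {q | q ∈ S ∧ q ≠ p ∧ d p q < ε} := h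
  rw [Filter.mem_biInf_of_directed] at h'
  · obtain ⟨ε, hε, h2⟩ := h'
    exact ⟨ε, hε, h2⟩
  · intro a ha b hb
    refine ⟨min a b, Set.mem_Ioi.2 (lt_min (Set.mem_Ioi.1 ha) (Set.mem_Ioi.1 hb)), ?_, ?_⟩
    · exact Filter.principal_mono.2 fun q hq => ⟨hq.1, hq.2.1, hq.2.2.trans_le (min_le_left _ _)⟩
    · exact Filter.principal_mono.2 fun q hq => ⟨hq.1, hq.2.1, hq.2.2.trans_le (min_le_right _ _)⟩
  · exact ⟨1, Set.mem_Ioi.2 one_pos⟩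

lemma IsDOpen.inter {n : ℕ} {d : Heis n → Heis n → ℝ} {U V : Set (Heis n)} (hU : IsDOpen d U)
    (hV : IsDOpen d V) : IsDOpen d (U ∩ V) := by
  rintro p ⟨h1, h2⟩
  obtain ⟨a, ha, ha'⟩ := hU p h1
  obtain ⟨b, hb, hb'⟩ := hV p h2
  exact ⟨min a b, lt_min ha hb, fun q (hq : d p q < min a b) =>
    ⟨ha' (show d p q < a from lt_of_lt_of_le hq (min_le_left _ _)),
    hb' (show d p q < b from lt_of_lt_of_le hq (min_le_right _ _))⟩⟩

lemma IsC1H.locallyClosed {n m : ℕ} {d : Heis n → Heis n → ℝ} {S : Set (Heis n)}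
    (hS : IsC1H d m S) : ∃ W, IsDOpen d W ∧ S ⊆ W ∧ IsDOpen d (W \ S) := by
  choose! U hU hpU f g hf hg hZ hdiff hli using hS
  refine ⟨⋃ p ∈ S, U p, ?_, fun p hp => Set.mem_biUnion hp (hpU p hp), ?_⟩
  · intro q hq
    simp only [Set.mem_iUnion] at hq
    obtain ⟨p, hp, hq⟩ := hq
    obtain ⟨ε, hε, h⟩ := hU p hp q hq
    exact ⟨ε, hε, h.trans (Set.subset_biUnion_of_mem (u := U) hp)⟩
  · rintro q ⟨hq, hqS⟩
    simp only [Set.mem_iUnion] at hq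
    obtain ⟨p, hp, hq⟩ := hq
    have hmem : ∀ x ∈ U p, (x ∈ S ↔ f p x = 0) := fun x hx => by
      have := Set.ext_iff.1 (hZ p hp) x
      simp only [Set.mem_inter_iff, hx, and_true] at this
      rw [this]
      simp [hx]
    obtain ⟨a, ha, ha'⟩ := hU p hp q hq
    have hne : f p q ≠ 0 := fun h => hqS ((hmem q hq).2 h)
    obtain ⟨b, hb, hb'⟩ := mem_dnhds ((hf p hp q hq).eventually_ne hne)
    refine ⟨min a b, lt_min ha hb, fun x (hx : d q x < min a b) => ?_⟩
    have hxU : x ∈ U p := ha' (show d q x < a from lt_of_lt_of_le hx (min_le_left _ _))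
    refine ⟨Set.mem_biUnion hp hxU, fun hxS => ?_⟩
    by_cases hxq : x = q
    · exact hqS (hxq ▸ hxS)
    · exact hb' ⟨hxU, hxq, lt_of_lt_of_le hx (min_le_right _ _)⟩ ((hmem x hxU).1 hxS)

lemma IsC1H.glue {n m : ℕ} {d : Heis n → Heis n → ℝ} {S V : ℕ → Set (Heis n)}
    (hS : ∀ i, IsC1H d m (S i)) (hV : ∀ i, IsDOpen d (V i))
    (hdis : ∀ i j, i ≠ j → Disjoint (V i) (V j)) : IsC1H d m (⋃ i, (S i ∩ V i)) := by
  intro p hp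
  obtain ⟨i, hpS, hpV⟩ := Set.mem_iUnion.1 hp
  obtain ⟨U, hU, hpU, f, g, hf, hg, hZ, hdiff, hli⟩ := hS i p hpS
  refine ⟨U ∩ V i, hU.inter (hV i), ⟨hpU, hpV⟩, f, g,
    fun q hq => (hf q hq.1).mono_left (dnhds_mono d Set.inter_subset_left q),
    fun q hq => (hg q hq.1).mono_left (dnhds_mono d Set.inter_subset_left q),
    ?_, fun q hq => hdiff q hq.1, fun q hq => hli q hq.1⟩
  ext x
  have hx := Set.ext_iff.1 hZ x
  constructor
  · rintro ⟨h1, h2, h3⟩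
    obtain ⟨j, hj, hjV⟩ := Set.mem_iUnion.1 h1
    have hij : j = i := by
      by_contra hne
      exact Set.disjoint_left.1 (hdis j i hne) hjV h3
    subst hij
    exact ⟨⟨h2, h3⟩, (hx.1 ⟨hj, h2⟩).2⟩
  · rintro ⟨⟨h2, h3⟩, h4⟩
    exact ⟨Set.mem_iUnion.2 ⟨i, (hx.2 ⟨h2, h4⟩).1, h3⟩, h2, h3⟩

lemma sphOuter_eq {n : ℕ} {d : Heis n → Heis n → ℝ} (hd : IsHomDist n d) {s : ℝ} (hs : 0 < s)
    (A : Set (Heis n)) : sphOuter d s A = @sphMeas (Heis n) (homMetric hd) s A :=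
  (@sphMeas_apply (Heis n) (homMetric hd) ⟨0⟩ s hs A).symm

/-- a set `R ⊂ ℍⁿ` with `S^{Q-m}(R) < ∞` is `ℍ`-rectifiable of codimension
`m ≤ n` (i.e. `S^{Q-m}`-almost all of `R` is covered by countably many `C¹_ℍ` submanifolds
of codimension `m`) if and only if for every `ε > 0` there is a single `C¹_ℍ` submanifold
`S` of codimension `m` with `S^{Q-m}(R \ S) < ε`. -/
theorem h_rectifiable_iff_single_submanifold {n m : ℕ} (hm1 : 1 ≤ m) (hmn : m ≤ n)
    (d : Heis n → Heis n → ℝ) (hd : IsHomDist n d) (R : Set (Heis n))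
    (hfin : sphOuter d (2 * (n : ℝ) + 2 - m) R < ⊤) :
    (∃ S : ℕ → Set (Heis n), (∀ i, IsC1H d m (S i)) ∧
        sphOuter d (2 * (n : ℝ) + 2 - m) (R \ ⋃ i, S i) = 0)
      ↔ (∀ ε : ℝ≥0∞, 0 < ε →
          ∃ S : Set (Heis n), IsC1H d m S ∧ sphOuter d (2 * (n : ℝ) + 2 - m) (R \ S) < ε) := by
  have hs : (0 : ℝ) < 2 * (n : ℝ) + 2 - m := by
    have : (m : ℝ) ≤ n := by exact_mod_cast hmn
    have : (0 : ℝ) ≤ n := Nat.cast_nonneg n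
    linarith
  simp only [sphOuter_eq hd hs] at hfin ⊢
  constructor
  · rintro ⟨S, hS, h0⟩ ε hε
    obtain ⟨V, hVo, hVd, hlt⟩ := @key_lemma (Heis n) (homMetric hd) _
      (@sphMeas_isMetric (Heis n) (homMetric hd) _) R hfin S
      (fun i => by
        obtain ⟨W, h1, h2, h3⟩ := (hS i).locallyClosed
        exact ⟨W, (isOpen_iff_isDOpen hd _).2 h1, h2, (isOpen_iff_isDOpen hd _).2 h3⟩) h0 ε hε
    exact ⟨_, IsC1H.glue hS (fun i => (isOpen_iff_isDOpen hd _).1 (hVo i)) hVd, hlt⟩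
  · intro h
    choose S hS hlt using fun i : ℕ => h ((i : ℝ≥0∞) + 1)⁻¹
      (ENNReal.inv_pos.2 (by finiteness))
    refine ⟨S, hS, ?_⟩
    by_contra hne
    obtain ⟨k, hk⟩ := ENNReal.exists_inv_nat_lt hne
    refine absurd hk (not_lt.2 ?_)
    refine (MeasureTheory.measure_mono
      (Set.sdiff_subset_sdiff_right (Set.subset_iUnion S k))).trans ((hlt k).le.trans ?_)
    exact ENNReal.inv_le_inv.2 le_self_add
end

section
/- Let S ⊂ H^n be a C¹_H submanifold of codimension m ≤ n, p ∈ S, u : S → R^ℓ Lipschitz, and L : T^H_p S → R^ℓ a homogeneous morphism. Then u is tangentially Pansu differentiable along S at p with differential L if and only if, for every Lipschitz extension ũ : H^n → R^ℓ of u, the restriction ũ|_{p T^H_p S} is Pansu differentiable at p with differential L, i.e., lim_{λ→∞} λ(ũ(p δ_{1/λ} x) − ũ(p)) = L(x) locally uniformly in x ∈ T^H_p S. -/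
open Filter Topology
open scoped BigOperators

/-- Kuratowski convergence of a one-parameter family of sets `F λ`, as `λ → ∞`. -/
def KurFam {α : Type*} [TopologicalSpace α] (F : ℝ → Set α) (F' : Set α) : Prop :=
  (∀ z ∈ F', ∀ lamj : ℕ → ℝ, Tendsto lamj atTop atTop →
      ∃ zj : ℕ → α, (∀ j, zj j ∈ F (lamj j)) ∧ Tendsto zj atTop (𝓝 z)) ∧
  (∀ (lamj : ℕ → ℝ) (zj : ℕ → α) (z : α), Tendsto lamj atTop atTop →
      (∀ j, zj j ∈ F (lamj j)) → Tendsto zj atTop (𝓝 z) → z ∈ F')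

/-- `u` is tangentially Pansu differentiable along `S` at `p` with differential `L` on the
tangent `T`: some group morphism `L̃ : ℍⁿ → ℝ^ℓ` restricting to `L` on `T` satisfies
`lim_{q→p, q∈S} |u(q)-u(p)-L̃(p⁻¹q)|/d(p,q) = 0`. -/
def TangPansuDiff {n ℓ : ℕ} (d : Heis n → Heis n → ℝ) (S T : Set (Heis n))
    (u : Heis n → Fin ℓ → ℝ) (p : Heis n) (L : Heis n → Fin ℓ → ℝ) : Prop :=
  ∃ Lt : Heis n → Fin ℓ → ℝ,
    (∀ a b : Heis n, Lt (Heis.mul a b) = Lt a + Lt b) ∧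
    (∀ w ∈ T, Lt w = L w) ∧
    Tendsto (fun q => ‖u q - u p - Lt (Heis.mul (Heis.inv p) q)‖ / d p q)
      (dnhds d S p) (𝓝 0)

open MeasureTheory in
theorem top_integral_monomial {ι : Type*} [Fintype ι] [DecidableEq ι]
    (η η' : ι → ℝ → ι → ℝ) (hd : ∀ i s j, HasDerivAt (fun s => η i s j) (η' i s j) s)
    (hc : ∀ i j, Continuous (fun s => η' i s j))
    (h0 : ∀ i, η i 0 = 0) (h1 : ∀ i, η i 1 = Pi.single i 1) (n : ι → ℤ) :
    ∫ s in Set.pi Set.univ (fun _ : ι => Set.Icc (0:ℝ) 1),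
      UnitAddTorus.mFourier n (fun j => ((∑ i, η i (s i) j : ℝ) : UnitAddCircle)) *
        (Matrix.of fun i j => ((η' i (s i) j : ℝ) : ℂ)).det = if n = 0 then 1 else 0 := by
  set E : ι → ℝ → ℂ := fun i s => Complex.exp (2 * Real.pi * Complex.I * ∑ j, (n j : ℂ) * (η i s j : ℂ)) with hE
  have hηc : ∀ i j, Continuous (fun s => η i s j) := fun i j =>
    continuous_iff_continuousAt.2 fun s => (hd i s j).continuousAt
  have hEc : ∀ i, Continuous (E i) := by
    intro i; simp only [hE]; fun_prop
  have hexp : ∀ s : ι → ℝ, UnitAddTorus.mFourier n (fun j => ((∑ i, η i (s i) j : ℝ) : UnitAddCircle)) = ∏ i, E i (s i) := by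
    intro s
    simp only [UnitAddTorus.mFourier, ContinuousMap.coe_mk, hE, fourier_coe_apply]
    rw [← Complex.exp_sum, ← Complex.exp_sum]
    congr 1
    push_cast
    simp only [Finset.mul_sum, div_one]
    rw [Finset.sum_comm]
    refine Finset.sum_congr rfl fun i _ => Finset.sum_congr rfl fun j _ => ?_
    ring
  set M : Matrix ι ι ℂ := Matrix.of fun i j => ∫ s in Set.Icc (0:ℝ) 1, E i s * (η' i s j : ℂ) with hM
  have key : ∫ s in Set.pi Set.univ (fun _ : ι => Set.Icc (0:ℝ) 1),
      UnitAddTorus.mFourier n (fun j => ((∑ i, η i (s i) j : ℝ) : UnitAddCircle)) *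
        (Matrix.of fun i j => ((η' i (s i) j : ℝ) : ℂ)).det = M.det := by
    have e1 : ∀ s : ι → ℝ, UnitAddTorus.mFourier n (fun j => ((∑ i, η i (s i) j : ℝ) : UnitAddCircle)) *
        (Matrix.of fun i j => ((η' i (s i) j : ℝ) : ℂ)).det
        = ∑ σ : Equiv.Perm ι, ((Equiv.Perm.sign σ : ℤ) : ℂ) * ∏ i, (E i (s i) * (η' i (s i) (σ i) : ℂ)) := by
      intro s
      rw [hexp, ← Matrix.det_transpose, Matrix.det_apply', Finset.mul_sum]
      refine Finset.sum_congr rfl fun σ _ => ?_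
      rw [Finset.prod_mul_distrib]
      simp only [Matrix.transpose_apply, Matrix.of_apply]
      ring
    simp only [e1]
    rw [integral_finsetSum]
    · rw [← Matrix.det_transpose, Matrix.det_apply']
      refine Finset.sum_congr rfl fun σ _ => ?_
      rw [integral_const_mul]
      congr 1
      rw [volume_pi, Measure.restrict_pi_pi]
      rw [integral_fintype_prod_eq_prod (f := fun i s => E i s * (η' i s (σ i) : ℂ))]
      simp [hM]
    · intro σ _
      rw [Set.pi_univ_Icc]
      apply Continuous.integrableOn_Icc
      refine continuous_const.mul (continuous_finsetProd _ fun i _ => ?_)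
      exact ((hEc i).comp (continuous_apply i)).mul (Complex.continuous_ofReal.comp ((hc i (σ i)).comp (continuous_apply i)))
  rw [key]
  split_ifs with hn
  · have : M = 1 := by
      ext i j
      have : M i j = ∫ s in Set.Icc (0:ℝ) 1, ((η' i s j : ℝ) : ℂ) := by
        simp [hM, hE, hn]
      rw [this, integral_complex_ofReal, integral_Icc_eq_integral_Ioc,
        ← intervalIntegral.integral_of_le zero_le_one,
        intervalIntegral.integral_eq_sub_of_hasDerivAt (fun s _ => hd i s j)
          ((hc i j).intervalIntegrable _ _), h0, h1]
      simp only [Matrix.one_apply, Pi.single_apply, Pi.zero_apply, sub_zero, eq_comm (a := j)]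
      split_ifs <;> simp
    rw [this, Matrix.det_one]
  · rw [← Matrix.exists_mulVec_eq_zero_iff]
    refine ⟨fun j => (n j : ℂ), ?_, ?_⟩
    · intro h; apply hn; ext j; have := congrFun h j; simpa using this
    · ext i
      simp only [Matrix.mulVec, dotProduct, hM, Matrix.of_apply, Pi.zero_apply]
      have hintble : ∀ j, IntegrableOn (fun s => E i s * (η' i s j : ℂ) * (n j : ℂ)) (Set.Icc (0:ℝ) 1) := by
        intro j
        apply Continuous.integrableOn_Icc
        exact ((hEc i).mul (Complex.continuous_ofReal.comp (hc i j))).mul continuous_const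
      have : ∑ j, (∫ s in Set.Icc (0:ℝ) 1, E i s * (η' i s j : ℂ)) * (n j : ℂ)
          = ∫ s in Set.Icc (0:ℝ) 1, ∑ j, E i s * (η' i s j : ℂ) * (n j : ℂ) := by
        rw [integral_finsetSum _ (fun j _ => hintble j)]
        simp only [integral_mul_const]
      rw [this, integral_Icc_eq_integral_Ioc, ← intervalIntegral.integral_of_le zero_le_one]
      have hder : ∀ s : ℝ, HasDerivAt (fun s => E i s / (2 * Real.pi * Complex.I)) (∑ j, E i s * (η' i s j : ℂ) * (n j : ℂ)) s := by
        intro s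
        have h1 : HasDerivAt (fun s : ℝ => ∑ j, (n j : ℂ) * (η i s j : ℂ)) (∑ j, (n j : ℂ) * (η' i s j : ℂ)) s := by
          apply HasDerivAt.fun_sum
          intro j _
          exact ((hd i s j).ofReal_comp).const_mul _
        have h2 := ((h1.const_mul (2 * Real.pi * Complex.I)).cexp).div_const (2 * Real.pi * Complex.I)
        have h3 : Complex.exp (2 * Real.pi * Complex.I * ∑ j, (n j : ℂ) * (η i s j : ℂ)) *
            (2 * Real.pi * Complex.I * ∑ j, (n j : ℂ) * (η' i s j : ℂ)) / (2 * Real.pi * Complex.I)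
            = ∑ j, E i s * (η' i s j : ℂ) * (n j : ℂ) := by
          rw [mul_left_comm, mul_div_cancel_left₀ _ Complex.two_pi_I_ne_zero, Finset.mul_sum]
          refine Finset.sum_congr rfl fun j _ => ?_
          simp only [hE]
          ring
        rw [h3] at h2
        exact h2
      rw [intervalIntegral.integral_eq_sub_of_hasDerivAt (fun s _ => hder s)]
      · have a0 : E i 0 = 1 := by simp [hE, h0]
        have a1 : E i 1 = 1 := by
          simp only [hE, h1]
          rw [Complex.exp_eq_one_iff]
          refine ⟨n i, ?_⟩
          have : ∑ j, (n j : ℂ) * ((Pi.single i (1:ℝ) : ι → ℝ) j : ℂ) = n i := by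
            rw [Finset.sum_eq_single i]
            · simp
            · intro j _ hj; simp [hj]
            · simp
          rw [this]
          ring
        rw [a0, a1, sub_self]
      · apply Continuous.intervalIntegrable
        refine continuous_finsetSum _ fun j _ => ?_
        exact ((hEc i).mul (Complex.continuous_ofReal.comp (hc i j))).mul continuous_const

open MeasureTheory in
theorem top_surj_C1 {ι : Type*} [Fintype ι] [DecidableEq ι]
    (η η' : ι → ℝ → ι → ℝ) (hd : ∀ i s j, HasDerivAt (fun s => η i s j) (η' i s j) s)
    (hc : ∀ i j, Continuous (fun s => η' i s j))
    (h0 : ∀ i, η i 0 = 0) (h1 : ∀ i, η i 1 = Pi.single i 1) (v : UnitAddTorus ι) :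
    ∃ s ∈ Set.pi Set.univ (fun _ : ι => Set.Icc (0:ℝ) 1),
      v = fun j => ((∑ i, η i (s i) j : ℝ) : UnitAddCircle) := by
  set Q := Set.pi Set.univ (fun _ : ι => Set.Icc (0:ℝ) 1) with hQ
  set G : (ι → ℝ) → UnitAddTorus ι := fun s j => ((∑ i, η i (s i) j : ℝ) : UnitAddCircle) with hG
  have hηc : ∀ i j, Continuous (fun s => η i s j) := fun i j =>
    continuous_iff_continuousAt.2 fun s => (hd i s j).continuousAt
  have hGc : Continuous G := by
    refine continuous_pi fun j => ?_
    refine (AddCircle.continuous_mk' (1:ℝ)).comp (continuous_finsetSum _ fun i _ => ?_)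
    exact (hηc i j).comp (continuous_apply i)
  set w : (ι → ℝ) → ℂ := fun s => (Matrix.of fun i j => ((η' i (s i) j : ℝ) : ℂ)).det with hw
  have hwc : Continuous w := by
    apply Continuous.matrix_det
    refine continuous_matrix fun i j => ?_
    exact Complex.continuous_ofReal.comp ((hc i j).comp (continuous_apply i))
  have hintble : ∀ F : (ι → ℝ) → ℂ, Continuous F → IntegrableOn F Q := by
    intro F hF
    rw [hQ, Set.pi_univ_Icc]
    exact hF.integrableOn_Icc
  let Φ : C(UnitAddTorus ι, ℂ) →L[ℂ] ℂ := LinearMap.mkContinuous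
    { toFun := fun ψ => ∫ s in Q, ψ (G s) * w s
      map_add' := by
        intro ψ₁ ψ₂
        have := integral_add (hintble _ ((ψ₁.continuous.comp hGc).mul hwc)) (hintble _ ((ψ₂.continuous.comp hGc).mul hwc))
        simpa [add_mul] using this
      map_smul' := by
        intro c ψ
        simp [mul_assoc, integral_const_mul] } (∫ s in Q, ‖w s‖) (by
      intro ψ
      simp only [LinearMap.coe_mk, AddHom.coe_mk]
      refine (norm_integral_le_integral_norm _).trans ?_
      rw [mul_comm, ← integral_const_mul]
      refine integral_mono (hintble _ ((ψ.continuous.comp hGc).mul hwc)).norm ((hintble _ hwc).norm.const_mul _) ?_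
      intro s
      simp only [norm_mul]
      exact mul_le_mul_of_nonneg_right (ψ.norm_coe_le_norm _) (norm_nonneg _))
  let μ : Measure (UnitAddTorus ι) := Measure.pi fun _ => AddCircle.haarAddCircle
  have hintbleμ : ∀ ψ : C(UnitAddTorus ι, ℂ), Integrable ψ μ := fun ψ =>
    ψ.continuous.integrable_of_hasCompactSupport (HasCompactSupport.of_compactSpace _)
  let Ψ : C(UnitAddTorus ι, ℂ) →L[ℂ] ℂ := LinearMap.mkContinuous
    { toFun := fun ψ => ∫ x, ψ x ∂μ
      map_add' := fun ψ₁ ψ₂ => by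
        rw [← integral_add (hintbleμ _) (hintbleμ _)]; rfl
      map_smul' := fun c ψ => by simp [integral_const_mul] } 1 (by
      intro ψ
      simp only [LinearMap.coe_mk, AddHom.coe_mk, one_mul]
      refine (norm_integral_le_of_norm_le_const (C := ‖ψ‖) (ae_of_all _ fun x => ψ.norm_coe_le_norm x)).trans ?_
      simp)
  have hΦΨ : Φ = Ψ := by
    refine ContinuousLinearMap.ext_on (s := Set.range UnitAddTorus.mFourier) ?_ ?_
    · rw [Submodule.dense_iff_topologicalClosure_eq_top]
      exact UnitAddTorus.span_mFourier_closure_eq_top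
    · rintro _ ⟨n, rfl⟩
      have a1 : Φ (UnitAddTorus.mFourier n) = if n = 0 then 1 else 0 :=
        top_integral_monomial η η' hd hc h0 h1 n
      have a2 : Ψ (UnitAddTorus.mFourier n) = if n = 0 then 1 else 0 := by
        change ∫ x, UnitAddTorus.mFourier n x ∂μ = _
        simp only [UnitAddTorus.mFourier, ContinuousMap.coe_mk]
        rw [integral_fintype_prod_eq_prod (f := fun i x => fourier (n i) x)]
        have hf : ∀ k : ℤ, ∫ x : UnitAddCircle, fourier k x ∂AddCircle.haarAddCircle = if k = 0 then 1 else 0 := by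
          intro k
          split_ifs with hk
          · simp [hk]
          · exact integral_eq_zero_of_add_right_eq_neg (fourier_add_half_inv_index hk one_pos)
        simp only [hf]
        rw [Finset.prod_ite_zero]
        simp [funext_iff]
      rw [a1, a2]
  by_contra hcon
  push Not at hcon
  have hK : IsCompact (G '' Q) := (isCompact_univ_pi fun _ => isCompact_Icc).image hGc
  have hvK : v ∉ G '' Q := by
    rintro ⟨s, hs, hsv⟩
    exact hcon s hs hsv.symm
  obtain ⟨ψ, hψ0, hψ1, hψ2⟩ := exists_continuous_zero_one_of_isClosed hK.isClosed (isClosed_singleton (x := v))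
    (Set.disjoint_singleton_right.2 hvK)
  have hpos : 0 < ∫ x, ψ x ∂μ := by
    apply ψ.continuous.integral_pos_of_hasCompactSupport_nonneg_nonzero (HasCompactSupport.of_compactSpace _) (x := v)
    · intro x; exact (hψ2 x).1
    · rw [hψ1 rfl]; simp
  let ψc : C(UnitAddTorus ι, ℂ) := ⟨fun x => (ψ x : ℂ), Complex.continuous_ofReal.comp ψ.continuous⟩
  have b1 : Φ ψc = 0 := by
    change ∫ s in Q, ψc (G s) * w s = 0
    apply setIntegral_eq_zero_of_forall_eq_zero
    intro s hs
    have : ψ (G s) = 0 := hψ0 ⟨s, hs, rfl⟩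
    simp [ψc, this]
  have b2 : Ψ ψc = ((∫ x, ψ x ∂μ : ℝ) : ℂ) := by
    change ∫ x, ψc x ∂μ = _
    rw [← integral_complex_ofReal]; rfl
  rw [hΦΨ, b2] at b1
  exact hpos.ne' (by exact_mod_cast b1)

theorem top_surj {ι : Type*} [Fintype ι] [DecidableEq ι]
    (γ : ι → ℝ → ι → ℝ) (hc : ∀ i j, ContinuousOn (fun s => γ i s j) (Set.Icc 0 1))
    (h0 : ∀ i, γ i 0 = 0) (h1 : ∀ i, γ i 1 = Pi.single i 1) (v : ι → ℝ) :
    ∃ s : ι → ℝ, (∀ i, s i ∈ Set.Icc (0:ℝ) 1) ∧ ∃ z : ι → ℤ, ∀ j, v j = z j + ∑ i, γ i (s i) j := by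
  set Q := Set.pi Set.univ (fun _ : ι => Set.Icc (0:ℝ) 1) with hQ
  set H : (ι → ℝ) → UnitAddTorus ι := fun s j => ((v j - ∑ i, γ i (s i) j : ℝ) : UnitAddCircle) with hH
  have hHc : ContinuousOn H Q := by
    refine continuousOn_pi.2 fun j => ?_
    refine (AddCircle.continuous_mk' (1:ℝ)).comp_continuousOn (continuousOn_const.sub (continuousOn_finsetSum _ fun i _ => ?_))
    exact (hc i j).comp (continuous_apply i).continuousOn fun s hs => hs i (Set.mem_univ i)
  have hQc : IsCompact Q := isCompact_univ_pi fun _ => isCompact_Icc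
  obtain ⟨s, hs, hmin⟩ := hQc.exists_isMinOn ⟨0, by intro i _; simp⟩ hHc.norm
  have hzero : ‖H s‖ = 0 := by
    by_contra hne
    have hpos : 0 < ‖H s‖ := lt_of_le_of_ne (norm_nonneg _) (Ne.symm hne)
    set ε := ‖H s‖ / (5 * (Fintype.card ι + 1)) with hε
    have hεpos : 0 < ε := by positivity
    have hP : ∀ i j, ∃ P : Polynomial ℝ, ∀ x ∈ Set.Icc (0:ℝ) 1, |P.eval x - γ i x j| < ε := fun i j =>
      exists_polynomial_near_of_continuousOn 0 1 _ (hc i j) ε hεpos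
    choose P hP using hP
    let R : ι → ι → Polynomial ℝ := fun i j =>
      P i j - Polynomial.C ((P i j).eval 0) - Polynomial.X * Polynomial.C ((P i j).eval 1 - (P i j).eval 0 - (Pi.single i 1 : ι → ℝ) j)
    obtain ⟨t, ht, htv⟩ := top_surj_C1 (fun i s j => (R i j).eval s) (fun i s j => (R i j).derivative.eval s)
      (fun i s j => (R i j).hasDerivAt s) (fun i j => (R i j).derivative.continuous)
      (fun i => by ext j; simp [R]) (fun i => by ext j; simp [R]) (fun j => (v j : UnitAddCircle))
    have hle := hmin ht
    change ‖H s‖ ≤ ‖H t‖ at hle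
    have hlt : ‖H t‖ < ‖H s‖ := by
      rw [pi_norm_lt_iff hpos]
      intro j
      have e1 : H t j = ((∑ i, ((R i j).eval (t i) - γ i (t i) j) : ℝ) : UnitAddCircle) := by
        have := congrFun htv j
        simp only [hH, AddCircle.coe_sub, Finset.sum_sub_distrib] at this ⊢
        rw [this]
      rw [e1]
      refine lt_of_le_of_lt (QuotientAddGroup.norm_mk_le_norm) ?_
      rw [Real.norm_eq_abs]
      have e2 : ∀ i, |(R i j).eval (t i) - γ i (t i) j| ≤ 4 * ε := by
        intro i
        have t1 := ht i (Set.mem_univ i)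
        have a := abs_lt.1 (hP i j (t i) t1)
        have b := abs_lt.1 (hP i j 0 (by simp))
        have c := abs_lt.1 (hP i j 1 (by simp))
        rw [h0] at b
        rw [h1] at c
        simp only [Pi.zero_apply, sub_zero] at b
        simp only [R, Polynomial.eval_sub, Polynomial.eval_mul, Polynomial.eval_X, Polynomial.eval_C]
        obtain ⟨t2, t3⟩ := t1
        set A := Polynomial.eval 1 (P i j)
        set B := Polynomial.eval 0 (P i j)
        set D := (Pi.single i (1:ℝ) : ι → ℝ) j
        have hT : |t i * (A - B - D)| ≤ 2 * ε := by
          rw [abs_mul, abs_of_nonneg t2]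
          have : |A - B - D| ≤ 2 * ε := by rw [abs_le]; constructor <;> linarith
          nlinarith [abs_nonneg (A - B - D)]
        have hT := abs_le.1 hT
        rw [abs_le]; constructor <;> linarith
      have e3 : |∑ i, ((R i j).eval (t i) - γ i (t i) j)| ≤ Fintype.card ι * (4 * ε) := by
        refine (Finset.abs_sum_le_sum_abs _ _).trans ((Finset.sum_le_sum fun i _ => e2 i).trans ?_)
        simp
      have e4 : ‖H s‖ = ε * (5 * (Fintype.card ι + 1)) := by rw [hε]; field_simp
      rw [e4]
      have : (0:ℝ) ≤ Fintype.card ι := by positivity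
      nlinarith
    linarith
  have hz : ∀ j, ∃ z : ℤ, v j = z + ∑ i, γ i (s i) j := by
    intro j
    have := congrFun (norm_eq_zero.1 hzero) j
    obtain ⟨z, hz⟩ := (AddCircle.coe_eq_zero_iff (1:ℝ)).1 this
    refine ⟨z, ?_⟩
    simp at hz
    linarith
  choose z hz using hz
  exact ⟨s, fun i => hs i (Set.mem_univ i), z, hz⟩

/-- An additive map which is bounded on a continuous curve through the origin is real-linear on the
span of the curve. -/
theorem additive_linear_on_curve {E F : Type*} [NormedAddCommGroup E] [NormedSpace ℝ E]
    [FiniteDimensional ℝ E] [NormedAddCommGroup F] [NormedSpace ℝ F] (A : E → F)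
    (hA : ∀ x y, A (x + y) = A x + A y) (γ : ℝ → E) (hγ : ContinuousOn γ (Set.Icc 0 1))
    (h0 : γ 0 = 0) (M : ℝ) (hM : ∀ s ∈ Set.Icc (0:ℝ) 1, ‖A (γ s)‖ ≤ M) :
    ∃ B : E →ₗ[ℝ] F, ∀ x ∈ Submodule.span ℝ (γ '' Set.Icc 0 1), A x = B x := by
  classical
  set X := Submodule.span ℝ (γ '' Set.Icc (0:ℝ) 1) with hX
  obtain ⟨b, hbs, hbspan, hbind⟩ := exists_linearIndependent ℝ (γ '' Set.Icc (0:ℝ) 1)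
  have : Finite b := hbind.finite
  have : Fintype b := Fintype.ofFinite b
  have hbasis : ∃ bas : Module.Basis b ℝ X, ∀ i, (bas i : E) = i := by
    have hsp : Submodule.span ℝ (Set.range ((↑) : b → E)) = X := by
      rw [Subtype.range_coe, hbspan]
    refine ⟨(Module.Basis.span hbind).map (LinearEquiv.ofEq _ _ hsp), fun i => ?_⟩
    simp [Module.Basis.span_apply]
  obtain ⟨bas, hbas⟩ := hbasis
  have ht : ∀ i : b, ∃ t ∈ Set.Icc (0:ℝ) 1, γ t = i := fun i => hbs i.2
  choose t ht htγ using ht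
  let A' : E →+ F := AddMonoidHom.mk' A hA
  have hγX : ∀ s ∈ Set.Icc (0:ℝ) 1, γ s ∈ X := fun s hs => Submodule.subset_span ⟨s, hs, rfl⟩
  have hst : ∀ (i : b) (s : ℝ), s ∈ Set.Icc (0:ℝ) 1 → s * t i ∈ Set.Icc (0:ℝ) 1 := fun i s hs =>
    ⟨mul_nonneg hs.1 (ht i).1, mul_le_one₀ hs.2 (ht i).1 (ht i).2⟩
  let pr : X → (b → ℝ) := fun x => bas.equivFun x
  have hprc : Continuous pr := (bas.equivFun : X →ₗ[ℝ] (b → ℝ)).continuous_of_finiteDimensional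
  -- coordinates of the curves
  let γ' : b → ℝ → b → ℝ := fun i s =>
    if h : s ∈ Set.Icc (0:ℝ) 1 then pr ⟨γ (s * t i), hγX _ (hst i s h)⟩ else 0
  have hγ'c : ∀ i j, ContinuousOn (fun s => γ' i s j) (Set.Icc 0 1) := by
    intro i j
    rw [continuousOn_iff_continuous_domRestrict]
    have : (Set.Icc (0:ℝ) 1).domRestrict (fun s => γ' i s j) = fun s : Set.Icc (0:ℝ) 1 => pr ⟨γ (s * t i), hγX _ (hst i s s.2)⟩ j := by
      ext s
      simp only [Set.domRestrict_apply, γ']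
      rw [dif_pos s.2]
    rw [this]
    refine (continuous_apply j).comp (hprc.comp ?_)
    refine Continuous.subtype_mk ?_ _
    exact hγ.comp_continuous (by fun_prop) (fun s => hst i s s.2)
  have hγ'0 : ∀ i, γ' i 0 = 0 := by
    intro i
    simp only [γ']
    rw [dif_pos (by simp)]
    have : (⟨γ (0 * t i), hγX _ (hst i 0 (by simp))⟩ : X) = 0 := by ext; simp [h0]
    rw [this]; simp [pr]
  have hγ'1 : ∀ i, γ' i 1 = Pi.single i 1 := by
    intro i
    simp only [γ']
    rw [dif_pos (by simp)]
    have : (⟨γ (1 * t i), hγX _ (hst i 1 (by simp))⟩ : X) = bas i := by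
      ext; rw [hbas]; simp [htγ]
    rw [this]; ext j; simp [pr, Pi.single_apply, Finsupp.single_apply, eq_comm]
  let B₀ : X →ₗ[ℝ] F := bas.constr ℝ (fun i => A i)
  obtain ⟨B, hB⟩ := LinearMap.exists_extend B₀
  have hBX : ∀ x : X, B x = B₀ x := fun x => by rw [← hB]; rfl
  refine ⟨B, ?_⟩
  -- bounded difference
  obtain ⟨C, hC⟩ : ∃ C : ℝ, ∀ s ∈ Set.Icc (0:ℝ) 1, ‖B (γ s)‖ ≤ C := by
    have : ContinuousOn (fun s => B (γ s)) (Set.Icc (0:ℝ) 1) :=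
      B.continuous_of_finiteDimensional.comp_continuousOn hγ
    exact isCompact_Icc.exists_bound_of_continuousOn this
  have hbd : ∀ x ∈ X, ‖A x - B x‖ ≤ Fintype.card b * (M + C) := by
    intro x hx
    obtain ⟨s, hs, z, hz⟩ := top_surj γ' hγ'c hγ'0 hγ'1 (pr ⟨x, hx⟩)
    have hxe : x = ∑ i : b, z i • (i : E) + ∑ i, γ (s i * t i) := by
      have : (⟨x, hx⟩ : X) = ∑ i, z i • bas i + ∑ i, ⟨γ (s i * t i), hγX _ (hst i _ (hs i))⟩ := by
        apply bas.equivFun.injective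
        ext j
        have := hz j
        simp only [γ', dif_pos (hs _)] at this
        rw [show bas.equivFun ⟨x, hx⟩ j = pr ⟨x, hx⟩ j from rfl, this]
        simp only [map_add, map_sum, Pi.add_apply, Finset.sum_apply, map_zsmul]
        congr 1
        rw [Finset.sum_eq_single j]
        · simp
        · intro i _ hi; simp [hi]
        · simp
      have h2 := congrArg (Subtype.val) this
      simpa [hbas] using h2
    have hA1 : A x = ∑ i : b, z i • A i + ∑ i, A (γ (s i * t i)) := by
      change A' x = _
      rw [hxe]
      simp only [map_add, map_sum, map_zsmul]; rfl
    have hB1 : B x = ∑ i : b, z i • A i + ∑ i, B (γ (s i * t i)) := by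
      rw [hxe]
      simp only [map_add, map_sum, map_zsmul]
      congr 1
      refine Finset.sum_congr rfl fun i _ => ?_
      rw [← hbas i, hBX]
      simp [B₀, hbas]
    rw [hA1, hB1, add_sub_add_left_eq_sub, ← Finset.sum_sub_distrib]
    refine (norm_sum_le _ _).trans ((Finset.sum_le_sum (g := fun _ => M + C) fun i _ => ?_).trans ?_)
    · refine (norm_sub_le _ _).trans (add_le_add (hM _ (hst i _ (hs i))) (hC _ (hst i _ (hs i))))
    · rw [Finset.sum_const, nsmul_eq_mul, Finset.card_univ]
  intro x hx
  by_contra hne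
  have hpos : 0 < ‖A x - B x‖ := norm_pos_iff.2 (sub_ne_zero.2 hne)
  obtain ⟨N, hN⟩ := exists_nat_gt ((Fintype.card b * (M + C)) / ‖A x - B x‖)
  have h1 := hbd (N • x) (X.nsmul_mem hx N)
  have h2 : A (N • x) = N • A x := map_nsmul A' N x
  rw [h2, map_nsmul, ← smul_sub, ← Nat.cast_smul_eq_nsmul ℝ, norm_smul] at h1
  rw [div_lt_iff₀ hpos] at hN
  rw [Real.norm_natCast] at h1
  linarith

namespace Heis

variable {n : ℕ}

theorem mul_assoc' (a b c : Heis n) : mul (mul a b) c = mul a (mul b c) := by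
  refine Prod.ext ?_ (Prod.ext ?_ ?_)
  · simp [mul, add_assoc]
  · simp [mul, add_assoc]
  · simp only [mul, Pi.add_apply]
    have : ∑ j, ((a.1 j + b.1 j) * c.2.1 j - c.1 j * (a.2.1 j + b.2.1 j))
        + ∑ j, (a.1 j * b.2.1 j - b.1 j * a.2.1 j)
        = ∑ j, (a.1 j * (b.2.1 j + c.2.1 j) - (b.1 j + c.1 j) * a.2.1 j)
        + ∑ j, (b.1 j * c.2.1 j - c.1 j * b.2.1 j) := by
      rw [← Finset.sum_add_distrib, ← Finset.sum_add_distrib]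
      exact Finset.sum_congr rfl fun j _ => by ring
    linarith

theorem mul_zero' (a : Heis n) : mul a 0 = a := by
  refine Prod.ext ?_ (Prod.ext ?_ ?_) <;> simp [mul]

theorem zero_mul' (a : Heis n) : mul 0 a = a := by
  refine Prod.ext ?_ (Prod.ext ?_ ?_) <;> simp [mul]

theorem inv_mul' (a : Heis n) : mul (inv a) a = 0 := by
  refine Prod.ext ?_ (Prod.ext ?_ ?_)
  · simp [mul, inv]
  · simp [mul, inv]
  · simp only [mul, inv, Pi.neg_apply]
    have : ∑ j, (-a.1 j * a.2.1 j - a.1 j * -a.2.1 j) = 0 :=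
      Finset.sum_eq_zero fun j _ => by ring
    rw [this]; simp

theorem mul_inv' (a : Heis n) : mul a (inv a) = 0 := by
  refine Prod.ext ?_ (Prod.ext ?_ ?_)
  · simp [mul, inv]
  · simp [mul, inv]
  · simp only [mul, inv, Pi.neg_apply]
    have : ∑ j, (a.1 j * -a.2.1 j - -a.1 j * a.2.1 j) = 0 :=
      Finset.sum_eq_zero fun j _ => by ring
    rw [this]; simp

theorem inv_mul_cancel' (a b : Heis n) : mul (inv a) (mul a b) = b := by
  rw [← mul_assoc', inv_mul', zero_mul']

theorem mul_inv_cancel' (a b : Heis n) : mul a (mul (inv a) b) = b := by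
  rw [← mul_assoc', mul_inv', zero_mul']

theorem dil_mul (c : ℝ) (a b : Heis n) : dil c (mul a b) = mul (dil c a) (dil c b) := by
  refine Prod.ext ?_ (Prod.ext ?_ ?_)
  · simp [mul, dil]
  · simp [mul, dil]
  · simp only [mul, dil, Pi.smul_apply, smul_eq_mul]
    have : ∑ j, (c * a.1 j * (c * b.2.1 j) - c * b.1 j * (c * a.2.1 j))
      = c ^ 2 * ∑ j, (a.1 j * b.2.1 j - b.1 j * a.2.1 j) := by
      rw [Finset.mul_sum]
      exact Finset.sum_congr rfl fun j _ => by ring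
    rw [this]; ring

theorem dil_dil (a b : ℝ) (w : Heis n) : dil a (dil b w) = dil (a * b) w := by
  refine Prod.ext ?_ (Prod.ext ?_ ?_)
  · simp [dil, smul_smul]
  · simp [dil, smul_smul]
  · simp [dil]; ring

theorem dil_one (w : Heis n) : dil 1 w = w := by
  refine Prod.ext ?_ (Prod.ext ?_ ?_) <;> simp [dil]

theorem dil_zero' (c : ℝ) : dil c (0 : Heis n) = 0 := by
  refine Prod.ext ?_ (Prod.ext ?_ ?_) <;> simp [dil]

theorem zero_dil (w : Heis n) : dil 0 w = 0 := by
  refine Prod.ext ?_ (Prod.ext ?_ ?_) <;> simp [dil]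

theorem hmul_cont : Continuous (fun w : Heis n × Heis n => mul w.1 w.2) := by
  unfold mul; fun_prop

theorem dil_cont : Continuous (fun w : ℝ × Heis n => dil w.1 w.2) := by
  unfold dil; fun_prop

theorem hinv_cont' : Continuous (fun w : Heis n => inv w) := by
  unfold inv; fun_prop

theorem hmul_left_cont (a : Heis n) : Continuous (fun w : Heis n => mul a w) := by
  unfold mul; fun_prop

end Heis

namespace IsHomDist

open Heis

theorem self {n : ℕ} {d : Heis n → Heis n → ℝ} (hd : IsHomDist n d) (p : Heis n) : d p p = 0 := (hd.eq_iff p p).2 rfl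

theorem nonneg_s17 {n : ℕ} {d : Heis n → Heis n → ℝ} (hd : IsHomDist n d) (p q : Heis n) : 0 ≤ d p q := by
  have := hd.triangle p q p
  rw [hd.self, hd.symm q p] at this
  linarith

theorem eq_N {n : ℕ} {d : Heis n → Heis n → ℝ} (hd : IsHomDist n d) (p q : Heis n) : d p q = d 0 (mul (inv p) q) := by
  rw [← hd.leftInv (inv p) p q, inv_mul']

theorem N_mul {n : ℕ} {d : Heis n → Heis n → ℝ} (hd : IsHomDist n d) (a b : Heis n) : d 0 (mul a b) ≤ d 0 a + d 0 b := by
  refine (hd.triangle 0 a _).trans ?_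
  rw [hd.eq_N a, inv_mul_cancel']

theorem N_inv {n : ℕ} {d : Heis n → Heis n → ℝ} (hd : IsHomDist n d) (a : Heis n) : d 0 (inv a) = d 0 a := by
  rw [← hd.leftInv a 0 (inv a), mul_zero', mul_inv', hd.symm]

theorem N_dil {n : ℕ} {d : Heis n → Heis n → ℝ} (hd : IsHomDist n d) (c : ℝ) (hc : 0 < c) (a : Heis n) : d 0 (dil c a) = c * d 0 a := by
  rw [← hd.homog c hc, dil_zero']

theorem N_abs_x {n : ℕ} {d : Heis n → Heis n → ℝ} (hd : IsHomDist n d) (c : ℝ) (x : Fin n → ℝ) : d 0 ((c • x, 0, 0) : Heis n) = |c| * d 0 ((x, 0, 0) : Heis n) := by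
  have key : ∀ c : ℝ, 0 < c → d 0 ((c • x, 0, 0) : Heis n) = c * d 0 ((x, 0, 0) : Heis n) := by
    intro c hc
    rw [← hd.N_dil c hc]; simp [dil]
  rcases lt_trichotomy c 0 with h | h | h
  · rw [abs_of_neg h, ← key (-c) (by linarith), ← hd.N_inv]; simp [inv]
  · subst h; simp only [zero_smul, abs_zero, zero_mul]; exact hd.self 0
  · rw [abs_of_pos h, key c h]

theorem N_abs_y {n : ℕ} {d : Heis n → Heis n → ℝ} (hd : IsHomDist n d) (c : ℝ) (x : Fin n → ℝ) : d 0 ((0, c • x, 0) : Heis n) = |c| * d 0 ((0, x, 0) : Heis n) := by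
  have key : ∀ c : ℝ, 0 < c → d 0 ((0, c • x, 0) : Heis n) = c * d 0 ((0, x, 0) : Heis n) := by
    intro c hc
    rw [← hd.N_dil c hc]; simp [dil]
  rcases lt_trichotomy c 0 with h | h | h
  · rw [abs_of_neg h, ← key (-c) (by linarith), ← hd.N_inv]; simp [inv]
  · subst h; simp only [zero_smul, abs_zero, zero_mul]; exact hd.self 0
  · rw [abs_of_pos h, key c h]

theorem N_t {n : ℕ} {d : Heis n → Heis n → ℝ} (hd : IsHomDist n d) (t : ℝ) : d 0 ((0, 0, t) : Heis n) = √|t| * d 0 ((0, 0, 1) : Heis n) := by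
  have key : ∀ t : ℝ, 0 < t → d 0 ((0, 0, t) : Heis n) = √t * d 0 ((0, 0, 1) : Heis n) := by
    intro t ht
    rw [← hd.N_dil _ (Real.sqrt_pos.2 ht)]; simp [dil, Real.sq_sqrt ht.le]
  rcases lt_trichotomy t 0 with h | h | h
  · rw [abs_of_neg h, ← key (-t) (by linarith), ← hd.N_inv]; simp [inv]
  · subst h; simp only [abs_zero, Real.sqrt_zero, zero_mul]; exact hd.self 0
  · rw [abs_of_pos h, key t h]

theorem N_x_le {n : ℕ} {d : Heis n → Heis n → ℝ} (hd : IsHomDist n d) (x : Fin n → ℝ) :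
    d 0 ((x, 0, 0) : Heis n) ≤ ∑ i, |x i| * d 0 ((Pi.single i 1, 0, 0) : Heis n) := by
  have h := Finset.le_sum_of_subadditive (fun x : Fin n → ℝ => d 0 ((x, 0, 0) : Heis n))
    (hd.self 0).le (fun x y => by
      have := hd.N_mul ((x, 0, 0) : Heis n) (y, 0, 0)
      simpa [mul] using this) Finset.univ (fun i => x i • (Pi.single i 1 : Fin n → ℝ))
  simp only [hd.N_abs_x] at h
  have e : ∑ i, x i • (Pi.single i 1 : Fin n → ℝ) = x := by
    ext j
    simp [Finset.sum_apply, Pi.single_apply]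
  rwa [e] at h

theorem N_y_le {n : ℕ} {d : Heis n → Heis n → ℝ} (hd : IsHomDist n d) (x : Fin n → ℝ) :
    d 0 ((0, x, 0) : Heis n) ≤ ∑ i, |x i| * d 0 ((0, Pi.single i 1, 0) : Heis n) := by
  have h := Finset.le_sum_of_subadditive (fun x : Fin n → ℝ => d 0 ((0, x, 0) : Heis n))
    (hd.self 0).le (fun x y => by
      have := hd.N_mul ((0, x, 0) : Heis n) (0, y, 0)
      simpa [mul] using this) Finset.univ (fun i => x i • (Pi.single i 1 : Fin n → ℝ))
  simp only [hd.N_abs_y] at h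
  have e : ∑ i, x i • (Pi.single i 1 : Fin n → ℝ) = x := by
    ext j
    simp [Finset.sum_apply, Pi.single_apply]
  rwa [e] at h

theorem N_le {n : ℕ} {d : Heis n → Heis n → ℝ} (hd : IsHomDist n d) (w : Heis n) : d 0 w ≤ ∑ i, |w.1 i| * d 0 ((Pi.single i 1, 0, 0) : Heis n)
    + ∑ i, |w.2.1 i| * d 0 ((0, Pi.single i 1, 0) : Heis n)
    + √|w.2.2 - (1 / 2) * ∑ j, w.1 j * w.2.1 j| * d 0 ((0, 0, 1) : Heis n) := by
  have e : w = mul (mul (w.1, 0, 0) (0, w.2.1, 0)) (0, 0, w.2.2 - (1 / 2) * ∑ j, w.1 j * w.2.1 j) := by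
    refine Prod.ext ?_ (Prod.ext ?_ ?_) <;> simp [mul]
  conv_lhs => rw [e]
  refine (hd.N_mul _ _).trans (add_le_add ((hd.N_mul _ _).trans (add_le_add (hd.N_x_le _) (hd.N_y_le _))) ?_)
  rw [hd.N_t]

theorem tendsto_N {n : ℕ} {d : Heis n → Heis n → ℝ} (hd : IsHomDist n d) : Tendsto (fun w : Heis n => d 0 w) (𝓝 0) (𝓝 0) := by
  refine squeeze_zero (fun w => hd.nonneg_s17 _ _) hd.N_le ?_
  have : Continuous (fun w : Heis n => ∑ i, |w.1 i| * d 0 ((Pi.single i 1, 0, 0) : Heis n)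
    + ∑ i, |w.2.1 i| * d 0 ((0, Pi.single i 1, 0) : Heis n)
    + √|w.2.2 - (1 / 2) * ∑ j, w.1 j * w.2.1 j| * d 0 ((0, 0, 1) : Heis n)) := by fun_prop
  have h := this.tendsto 0
  simpa using h

theorem tendsto_d {n : ℕ} {d : Heis n → Heis n → ℝ} (hd : IsHomDist n d) (p : Heis n) : Tendsto (fun q : Heis n => d p q) (𝓝 p) (𝓝 0) := by
  have h : Tendsto (fun q : Heis n => mul (inv p) q) (𝓝 p) (𝓝 0) := by
    have := (hmul_left_cont (inv p)).tendsto p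
    rwa [inv_mul'] at this
  refine (hd.tendsto_N.comp h).congr fun q => ?_
  simp only [Function.comp]
  rw [← hd.eq_N]

theorem continuous_N {n : ℕ} {d : Heis n → Heis n → ℝ} (hd : IsHomDist n d) : Continuous (fun w : Heis n => d 0 w) := by
  rw [continuous_iff_continuousAt]
  intro p
  have h := hd.tendsto_d p
  rw [ContinuousAt, tendsto_iff_dist_tendsto_zero]
  refine squeeze_zero (fun w => dist_nonneg) (fun q => ?_) h
  rw [Real.dist_eq, abs_le]
  have h1 := hd.triangle 0 p q
  have h2 := hd.triangle 0 q p
  rw [hd.symm q p] at h2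
  constructor <;> linarith

/-- comparison with the standard gauge -/
theorem gauge_le {n : ℕ} {d : Heis n → Heis n → ℝ} (hd : IsHomDist n d) : ∃ c : ℝ, 0 < c ∧ ∀ w : Heis n,
    c * max (max ‖w.1‖ ‖w.2.1‖) (√|w.2.2|) ≤ d 0 w := by
  let ρ : Heis n → ℝ := fun w => max (max ‖w.1‖ ‖w.2.1‖) (√|w.2.2|)
  have hρc : Continuous ρ := by fun_prop
  have hρ0 : ∀ w, 0 ≤ ρ w := fun w => le_max_of_le_right (Real.sqrt_nonneg _)
  have hρz : ∀ w, ρ w = 0 → w = 0 := by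
    intro w hw
    have h1 : ‖w.1‖ ≤ 0 := hw ▸ (le_max_left _ _).trans (le_max_left _ _)
    have h2 : ‖w.2.1‖ ≤ 0 := hw ▸ (le_max_right _ _).trans (le_max_left _ _)
    have h3 : √|w.2.2| ≤ 0 := hw ▸ (le_max_right _ _)
    refine Prod.ext (norm_le_zero_iff.1 h1) (Prod.ext (norm_le_zero_iff.1 h2) ?_)
    have := Real.sqrt_eq_zero'.1 (le_antisymm h3 (Real.sqrt_nonneg _))
    simpa using this
  have hρd : ∀ (c : ℝ) (w : Heis n), 0 < c → ρ (dil c w) = c * ρ w := by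
    intro c w hc
    simp only [ρ, dil, norm_smul, Real.norm_eq_abs, abs_mul, abs_of_pos hc, abs_pow]
    rw [Real.sqrt_mul (by positivity), Real.sqrt_sq hc.le, mul_max_of_nonneg _ _ hc.le,
      mul_max_of_nonneg _ _ hc.le]
  have hK : IsCompact {w : Heis n | ρ w = 1} := by
    refine Metric.isCompact_of_isClosed_isBounded (isClosed_eq hρc continuous_const) ?_
    refine (Metric.isBounded_closedBall (x := (0 : Heis n)) (r := 1)).subset ?_
    intro w hw
    have hw : ρ w = 1 := hw
    rw [mem_closedBall_zero_iff]
    have h1 : ‖w.1‖ ≤ 1 := hw ▸ (le_max_left _ _).trans (le_max_left _ _)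
    have h2 : ‖w.2.1‖ ≤ 1 := hw ▸ (le_max_right _ _).trans (le_max_left _ _)
    have h3 : √|w.2.2| ≤ 1 := hw ▸ (le_max_right _ _)
    refine norm_prod_le_iff.2 ⟨h1, norm_prod_le_iff.2 ⟨h2, ?_⟩⟩
    rw [Real.sqrt_le_left zero_le_one, one_pow] at h3
    exact h3
  have hne : ({w : Heis n | ρ w = 1}).Nonempty := ⟨(0, 0, 1), by
    change ρ _ = 1
    simp [ρ]⟩
  obtain ⟨w₀, hw₀, hmin⟩ := hK.exists_isMinOn hne hd.continuous_N.continuousOn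
  have hw₀ : ρ w₀ = 1 := hw₀
  refine ⟨d 0 w₀, ?_, ?_⟩
  · refine lt_of_le_of_ne (hd.nonneg_s17 _ _) fun h => ?_
    have := (hd.eq_iff 0 w₀).1 h.symm
    rw [← this] at hw₀
    simp [ρ] at hw₀
  · intro w
    change d 0 w₀ * ρ w ≤ _
    rcases eq_or_lt_of_le (hρ0 w) with h | h
    · rw [← h, mul_zero]; exact hd.nonneg_s17 _ _
    · have e : w = dil (ρ w) (dil (ρ w)⁻¹ w) := by
        rw [dil_dil, mul_inv_cancel₀ h.ne', dil_one]
      have h1 : ρ (dil (ρ w)⁻¹ w) = 1 := by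
        rw [hρd _ _ (inv_pos.2 h), inv_mul_cancel₀ h.ne']
      have h2 : d 0 w₀ ≤ d 0 (dil (ρ w)⁻¹ w) := hmin h1
      have h3 : d 0 w = ρ w * d 0 (dil (ρ w)⁻¹ w) := by
        rw [← hd.N_dil _ h, ← e]
      rw [h3, mul_comm]
      exact mul_le_mul_of_nonneg_left h2 h.le

theorem isCompact_unit {n : ℕ} {d : Heis n → Heis n → ℝ} (hd : IsHomDist n d) : IsCompact {w : Heis n | d 0 w = 1} := by
  obtain ⟨c, hc, h⟩ := hd.gauge_le
  refine Metric.isCompact_of_isClosed_isBounded (isClosed_eq hd.continuous_N continuous_const) ?_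
  refine (Metric.isBounded_closedBall (x := (0 : Heis n)) (r := max c⁻¹ (c⁻¹ ^ 2))).subset ?_
  intro w hw
  have hw : d 0 w = 1 := hw
  have hm := h w
  rw [hw, ← le_div_iff₀' hc, one_div] at hm
  rw [mem_closedBall_zero_iff]
  have h1 : ‖w.1‖ ≤ c⁻¹ := ((le_max_left _ _).trans (le_max_left _ _)).trans hm
  have h2 : ‖w.2.1‖ ≤ c⁻¹ := ((le_max_right _ _).trans (le_max_left _ _)).trans hm
  have h3 : √|w.2.2| ≤ c⁻¹ := (le_max_right _ _).trans hm
  rw [Real.sqrt_le_left (by positivity)] at h3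
  exact norm_prod_le_iff.2 ⟨h1.trans (le_max_left _ _), norm_prod_le_iff.2 ⟨h2.trans (le_max_left _ _), h3.trans (le_max_right _ _)⟩⟩

theorem nhds_basis {n : ℕ} {d : Heis n → Heis n → ℝ} (hd : IsHomDist n d) (p : Heis n) : (𝓝 p).HasBasis (fun ε : ℝ => 0 < ε) (fun ε => {q | d p q < ε}) := by
  have hcomap : 𝓝 p = comap (fun q => d p q) (𝓝 0) := by
    apply le_antisymm
    · exact (hd.tendsto_d p).le_comap
    · obtain ⟨c, hc, h⟩ := hd.gauge_le
      have h1 : Tendsto (fun q => mul (inv p) q) (comap (fun q => d p q) (𝓝 0)) (𝓝 0) := by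
        have hb : ∀ q, c * max (max ‖(mul (inv p) q).1‖ ‖(mul (inv p) q).2.1‖) (√|(mul (inv p) q).2.2|) ≤ d p q := by
          intro q; rw [hd.eq_N p q]; exact h _
        have ht : Tendsto (fun q => c⁻¹ * d p q) (comap (fun q => d p q) (𝓝 0)) (𝓝 0) := by
          have : Tendsto (fun q => d p q) (comap (fun q => d p q) (𝓝 0)) (𝓝 0) := tendsto_comap
          simpa using this.const_mul c⁻¹
        have hb' : ∀ q, max (max ‖(mul (inv p) q).1‖ ‖(mul (inv p) q).2.1‖) (√|(mul (inv p) q).2.2|) ≤ c⁻¹ * d p q := by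
          intro q
          rw [inv_mul_eq_div, le_div_iff₀' hc]; exact hb q
        refine Tendsto.prodMk_nhds ?_ (Tendsto.prodMk_nhds ?_ ?_)
        · rw [tendsto_zero_iff_norm_tendsto_zero]
          exact squeeze_zero (fun _ => norm_nonneg _) (fun q => ((le_max_left _ _).trans (le_max_left _ _)).trans (hb' q)) ht
        · rw [tendsto_zero_iff_norm_tendsto_zero]
          exact squeeze_zero (fun _ => norm_nonneg _) (fun q => ((le_max_right _ _).trans (le_max_left _ _)).trans (hb' q)) ht
        · rw [tendsto_zero_iff_abs_tendsto_zero]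
          have h3 : Tendsto (fun q => √|(mul (inv p) q).2.2|) (comap (fun q => d p q) (𝓝 0)) (𝓝 0) :=
            squeeze_zero (fun _ => Real.sqrt_nonneg _) (fun q => (le_max_right _ _).trans (hb' q)) ht
          have h4 := h3.pow 2
          simp only [Real.sq_sqrt (abs_nonneg _)] at h4
          rw [zero_pow two_ne_zero] at h4
          exact h4
      have h2 := ((hmul_left_cont p).tendsto 0).comp h1
      rw [mul_zero'] at h2
      refine le_trans ?_ h2
      have : (fun w => mul p w) ∘ (fun q => mul (inv p) q) = id := by
        ext1 q; simp only [Function.comp, mul_inv_cancel', id]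
      rw [this, map_id]
  rw [hcomap]
  refine (Metric.nhds_basis_ball.comap _).congr (fun _ => Iff.rfl) fun ε _ => ?_
  ext q
  simp [abs_of_nonneg (hd.nonneg_s17 p q)]

theorem dnhds_eq {n : ℕ} {d : Heis n → Heis n → ℝ} (hd : IsHomDist n d) (S : Set (Heis n)) (p : Heis n) : dnhds d S p = 𝓝[S \ {p}] p := by
  rw [nhdsWithin, (hd.nhds_basis p).eq_biInf, dnhds, biInf_inf (p := fun ε : ℝ => 0 < ε) ⟨1, one_pos⟩]
  simp only [inf_principal]
  refine iInf_congr fun ε => iInf_congr fun _ => ?_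
  congr 1
  ext q
  simp only [Set.mem_inter_iff, Set.mem_sdiff, Set.mem_singleton_iff]
  exact ⟨fun h => ⟨h.2.2, h.1, h.2.1⟩, fun h => ⟨h.2.1, h.2.2, h.1⟩⟩

theorem isOpen {n : ℕ} {d : Heis n → Heis n → ℝ} (hd : IsHomDist n d) {U : Set (Heis n)} (hU : IsDOpen d U) : IsOpen U := by
  rw [isOpen_iff_mem_nhds]
  intro p hp
  exact (hd.nhds_basis p).mem_iff.2 (hU p hp)

end IsHomDist

open Module in
theorem exists_isotropic_aux {V : Type*} [AddCommGroup V] [Module ℝ V] [FiniteDimensional ℝ V]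
    (B : LinearMap.BilinForm ℝ V) (hB : B.Nondegenerate) (hA : ∀ x, B x x = 0) (hR : B.IsRefl)
    (R : Submodule ℝ V) (N : ℕ) (hN : finrank ℝ V = 2 * N) :
    ∀ (r : ℕ) (W : Submodule ℝ V), W ≤ B.orthogonal W → W ⊓ R = ⊥ →
      finrank ℝ (R ⊓ B.orthogonal W : Submodule ℝ V) ≤ r → finrank ℝ W + r ≤ N →
      ∃ W' : Submodule ℝ V, W' ≤ B.orthogonal W' ∧ R ⊓ B.orthogonal W' = ⊥ := by
  intro r
  induction r with
  | zero =>
    intro W h1 h2 h3 h4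
    exact ⟨W, h1, Submodule.finrank_eq_zero.1 (Nat.le_zero.1 h3)⟩
  | succ r ih =>
    intro W h1 h2 h3 h4
    by_cases hbot : R ⊓ B.orthogonal W = ⊥
    · exact ⟨W, h1, hbot⟩
    set Rk := R ⊓ B.orthogonal W with hRk
    have hA1 : ∃ v ∈ B.orthogonal W, v ∉ B.orthogonal Rk := by
      by_contra! h
      have h' : B.orthogonal W ≤ B.orthogonal Rk := h
      have h'' := LinearMap.BilinForm.orthogonal_le (B := B) h'
      rw [LinearMap.BilinForm.orthogonal_orthogonal hB hR,
        LinearMap.BilinForm.orthogonal_orthogonal hB hR] at h''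
      apply hbot
      rw [eq_bot_iff, ← h2]
      exact le_inf h'' inf_le_left
    have hA2 : ∃ v ∈ B.orthogonal W, v ∉ W ⊔ R := by
      by_contra! h
      have h' : B.orthogonal W ≤ W ⊔ R := h
      have h'' : B.orthogonal W ≤ W ⊔ Rk := by
        rw [hRk, ← sup_inf_assoc_of_le R h1]
        exact le_inf h' le_rfl
      have e1 := Submodule.finrank_mono h''
      rw [LinearMap.BilinForm.finrank_orthogonal hB, hN] at e1
      have e2 := Submodule.finrank_add_le_finrank_add_finrank W Rk
      omega
    obtain ⟨v, hv, hv1, hv2⟩ : ∃ v ∈ B.orthogonal W, v ∉ B.orthogonal Rk ∧ v ∉ W ⊔ R := by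
      obtain ⟨a, ha, ha'⟩ := hA1
      obtain ⟨b, hb, hb'⟩ := hA2
      by_cases hab : a ∈ W ⊔ R
      · by_cases hba : b ∈ B.orthogonal Rk
        · refine ⟨a + b, Submodule.add_mem _ ha hb, fun h => ha' ?_, fun h => hb' ?_⟩
          · simpa using Submodule.sub_mem _ h hba
          · simpa using Submodule.sub_mem _ h hab
        · exact ⟨b, hb, hba, hb'⟩
      · exact ⟨a, ha, ha', hab⟩
    have hvW : ∀ w ∈ W, B w v = 0 := hv
    refine ih (W ⊔ Submodule.span ℝ {v}) ?_ ?_ ?_ ?_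
    · intro x hx
      rw [Submodule.mem_sup] at hx
      obtain ⟨w, hw, y, hy, rfl⟩ := hx
      obtain ⟨c, rfl⟩ := Submodule.mem_span_singleton.1 hy
      rw [LinearMap.BilinForm.mem_orthogonal_iff]
      intro x' hx'
      rw [Submodule.mem_sup] at hx'
      obtain ⟨w', hw', y', hy', rfl⟩ := hx'
      obtain ⟨c', rfl⟩ := Submodule.mem_span_singleton.1 hy'
      have e1 : B w' w = 0 := h1 hw w' hw'
      have e2 : B w' v = 0 := hvW w' hw'
      have e3 : B v w = 0 := hR _ _ (hvW w hw)
      simp [e1, e2, e3, hA]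
    · rw [eq_bot_iff]
      rintro x ⟨hx, hxR⟩
      have hx : x ∈ W ⊔ Submodule.span ℝ {v} := hx
      rw [Submodule.mem_sup] at hx
      obtain ⟨w, hw, y, hy, rfl⟩ := hx
      obtain ⟨c, rfl⟩ := Submodule.mem_span_singleton.1 hy
      have hc : c = 0 := by
        by_contra hc
        apply hv2
        have : v = (-c⁻¹) • w + c⁻¹ • (w + c • v) := by
          rw [smul_add, smul_smul, inv_mul_cancel₀ hc, one_smul, neg_smul]; abel
        rw [this]
        exact Submodule.add_mem_sup (Submodule.smul_mem _ _ hw) (Submodule.smul_mem _ _ hxR)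
      subst hc
      rw [zero_smul, add_zero] at hxR ⊢
      rw [← h2]
      exact ⟨hw, hxR⟩
    · have hlt : R ⊓ B.orthogonal (W ⊔ Submodule.span ℝ {v}) < Rk := by
        refine lt_of_le_of_ne (inf_le_inf_left _ (LinearMap.BilinForm.orthogonal_le le_sup_left)) ?_
        intro he
        apply hv1
        rw [LinearMap.BilinForm.mem_orthogonal_iff]
        intro x hx
        rw [← he] at hx
        have := hx.2 v (Submodule.mem_sup_right (Submodule.mem_span_singleton_self v))
        exact hR _ _ this
      have := Submodule.finrank_lt_finrank_of_lt hlt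
      omega
    · have e2 := Submodule.finrank_add_le_finrank_add_finrank W (Submodule.span ℝ {v})
      have e3 : finrank ℝ (Submodule.span ℝ {v}) ≤ 1 := by
        simpa using finrank_span_le_card (R := ℝ) ({v} : Set V)
      omega

/-- the symplectic form -/
noncomputable def sympl (n : ℕ) : LinearMap.BilinForm ℝ ((Fin n → ℝ) × (Fin n → ℝ)) :=
  LinearMap.mk₂ ℝ (fun v w => ∑ j, (v.1 j * w.2 j - w.1 j * v.2 j))
    (fun a b c => by
      rw [← Finset.sum_add_distrib]
      exact Finset.sum_congr rfl fun j _ => by simp; ring)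
    (fun r a b => by
      rw [smul_eq_mul, Finset.mul_sum]
      exact Finset.sum_congr rfl fun j _ => by simp; ring)
    (fun a b c => by
      rw [← Finset.sum_add_distrib]
      exact Finset.sum_congr rfl fun j _ => by simp; ring)
    (fun r a b => by
      rw [smul_eq_mul, Finset.mul_sum]
      exact Finset.sum_congr rfl fun j _ => by simp; ring)

theorem sympl_apply {n : ℕ} (v w : (Fin n → ℝ) × (Fin n → ℝ)) :
    sympl n v w = ∑ j, (v.1 j * w.2 j - w.1 j * v.2 j) := rfl

theorem sympl_neg {n : ℕ} (v w : (Fin n → ℝ) × (Fin n → ℝ)) :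
    sympl n v w = - sympl n w v := by
  rw [sympl_apply, sympl_apply, ← Finset.sum_neg_distrib]
  exact Finset.sum_congr rfl fun j _ => by ring

theorem sympl_refl (n : ℕ) : (sympl n).IsRefl := by
  intro v w h
  rw [sympl_neg, h, neg_zero]

theorem sympl_self {n : ℕ} (v : (Fin n → ℝ) × (Fin n → ℝ)) : sympl n v v = 0 := by
  have := sympl_neg v v
  linarith

theorem sympl_nondeg (n : ℕ) : (sympl n).Nondegenerate := by
  refine (sympl_refl n).nondegenerate_iff_separatingLeft.2 ?_
  intro v hv
  refine Prod.ext ?_ ?_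
  · ext i
    have := hv (0, Pi.single i 1)
    simpa [sympl_apply, Pi.single_apply] using this
  · ext i
    have := hv (Pi.single i 1, 0)
    simpa [sympl_apply, Pi.single_apply] using this

open Module in
/-- isotropic right inverse -/
theorem exists_isotropic_right_inverse {n m : ℕ} (hmn : m ≤ n)
    (g : Fin m → (Fin n → ℝ) × (Fin n → ℝ)) (hg : LinearIndependent ℝ g) :
    ∃ B : (Fin m → ℝ) →ₗ[ℝ] (Fin n → ℝ) × (Fin n → ℝ),
      (∀ y y', ∑ j, ((B y).1 j * (B y').2 j - (B y').1 j * (B y).2 j) = 0) ∧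
      ∀ y i, ∑ j, (g i).1 j * (B y).1 j + ∑ j, (g i).2 j * (B y).2 j = y i := by
  let Jg : Fin m → (Fin n → ℝ) × (Fin n → ℝ) := fun i => (-(g i).2, (g i).1)
  have hJ : ∀ v i, sympl n v (Jg i) = ∑ j, (g i).1 j * v.1 j + ∑ j, (g i).2 j * v.2 j := by
    intro v i
    rw [sympl_apply, ← Finset.sum_add_distrib]
    exact Finset.sum_congr rfl fun j _ => by simp [Jg]; ring
  let R := Submodule.span ℝ (Set.range Jg)
  have hRdim : finrank ℝ R ≤ m := by
    have := finrank_range_le_card (R := ℝ) Jg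
    simpa [Set.finrank] using this
  obtain ⟨W, hW, hWR⟩ := exists_isotropic_aux (sympl n) (sympl_nondeg n) sympl_self (sympl_refl n) R n
    (by simp; ring) m ⊥ bot_le (by simp) (le_trans (Submodule.finrank_mono inf_le_left) hRdim)
    (by simpa using hmn)
  have hli : LinearIndependent ℝ Jg := by
    let J : ((Fin n → ℝ) × (Fin n → ℝ)) →ₗ[ℝ] ((Fin n → ℝ) × (Fin n → ℝ)) :=
      LinearMap.prod (-LinearMap.snd ℝ _ _) (LinearMap.fst ℝ _ _)
    have : Jg = J ∘ g := by ext i <;> simp [Jg, J]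
    rw [this]
    refine hg.map' J (LinearMap.ker_eq_bot'.2 ?_)
    intro v hv
    have h1 : -v.2 = 0 := congrArg Prod.fst hv
    have h2 : v.1 = 0 := congrArg Prod.snd hv
    exact Prod.ext h2 (neg_eq_zero.1 h1)
  let P : W →ₗ[ℝ] (Fin m → ℝ) := LinearMap.pi fun i => ((sympl n).flip (Jg i)).comp W.subtype
  have hP : ∀ (w : W) i, P w i = sympl n w (Jg i) := fun w i => rfl
  have hsurj : LinearMap.range P = ⊤ := by
    by_contra hne
    obtain ⟨φ, hφ, hle⟩ := Submodule.exists_le_ker_of_lt_top _ (lt_top_iff_ne_top.2 hne)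
    apply hφ
    let c : Fin m → ℝ := fun i => φ (Pi.single i 1)
    have hφc : ∀ y, φ y = ∑ i, y i * c i := by
      intro y
      conv_lhs => rw [pi_eq_sum_univ' y]
      simp [c, map_sum]
    have hz : ∑ i, c i • Jg i ∈ R ⊓ (sympl n).orthogonal W := by
      refine ⟨Submodule.sum_mem _ fun i _ => Submodule.smul_mem _ _ (Submodule.subset_span ⟨i, rfl⟩), ?_⟩
      intro w hw
      have h0 : φ (P ⟨w, hw⟩) = 0 := hle ⟨_, rfl⟩
      rw [hφc] at h0
      simp only [hP] at h0
      change sympl n w _ = 0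
      rw [map_sum, ← h0]
      exact Finset.sum_congr rfl fun i _ => by rw [map_smul, smul_eq_mul, mul_comm]
    rw [hWR, Submodule.mem_bot] at hz
    have hc := Fintype.linearIndependent_iff.1 hli c hz
    ext1 i
    ext
    simpa [c] using hc i
  obtain ⟨Q, hQ⟩ := P.exists_rightInverse_of_surjective hsurj
  refine ⟨W.subtype.comp Q, ?_, ?_⟩
  · intro y y'
    exact hW (Q y').2 _ (Q y).2
  · intro y i
    rw [← hJ]
    have := congrFun (LinearMap.congr_fun hQ y) i
    simpa [hP] using this

theorem implicit_curve {m : ℕ} (F : ℝ → (Fin m → ℝ) → (Fin m → ℝ)) (r s0 : ℝ) (hr : 0 < r) (hs0 : 0 < s0)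
    (hF : ∀ s ∈ Set.Icc 0 s0, ∀ y ∈ Metric.closedBall (0 : Fin m → ℝ) r,
      ∀ y' ∈ Metric.closedBall (0 : Fin m → ℝ) r, ‖F s y - F s y' - (y - y')‖ ≤ (1 / 2) * ‖y - y'‖)
    (hc : ∀ y ∈ Metric.closedBall (0 : Fin m → ℝ) r, ContinuousOn (fun s => F s y) (Set.Icc 0 s0))
    (h0 : F 0 0 = 0) :
    ∃ s1 : ℝ, 0 < s1 ∧ s1 ≤ s0 ∧ ∃ y : ℝ → (Fin m → ℝ), ContinuousOn y (Set.Icc 0 s1) ∧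
      ∀ s ∈ Set.Icc 0 s1, y s ∈ Metric.closedBall (0 : Fin m → ℝ) r ∧ F s (y s) = 0 ∧ ‖y s‖ ≤ 2 * ‖F s 0‖ := by
  have hz : (0 : Fin m → ℝ) ∈ Metric.closedBall (0 : Fin m → ℝ) r := Metric.mem_closedBall_self hr.le
  have hexp : ∀ s ∈ Set.Icc 0 s0, ∀ y ∈ Metric.closedBall (0 : Fin m → ℝ) r,
      ∀ y' ∈ Metric.closedBall (0 : Fin m → ℝ) r, ‖y - y'‖ ≤ 2 * ‖F s y - F s y'‖ := by
    intro s hs y hy y' hy'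
    have h1 := hF s hs y hy y' hy'
    have h2 : ‖y - y'‖ ≤ ‖F s y - F s y'‖ + ‖F s y - F s y' - (y - y')‖ := by
      have : y - y' = (F s y - F s y') - (F s y - F s y' - (y - y')) := by abel
      conv_lhs => rw [this]
      exact norm_sub_le _ _
    linarith
  have hev : ∀ᶠ s in 𝓝[Set.Icc 0 s0] (0 : ℝ), ‖F s 0‖ < r / 2 := by
    have h1 := (hc 0 hz 0 ⟨le_rfl, hs0.le⟩).norm
    have h2 : ‖F 0 0‖ < r / 2 := by rw [h0, norm_zero]; positivity
    exact h1.eventually (gt_mem_nhds h2)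
  obtain ⟨δ, hδ, hδs⟩ := Metric.mem_nhdsWithin_iff.1 hev
  have hsmall : ∀ s ∈ Set.Icc 0 (min s0 (δ / 2)), s ∈ Set.Icc 0 s0 ∧ ‖F s 0‖ ≤ r / 2 := by
    intro s hs
    have h1 : s ∈ Set.Icc 0 s0 := ⟨hs.1, hs.2.trans (min_le_left _ _)⟩
    refine ⟨h1, (hδs ⟨?_, h1⟩).le⟩
    rw [Metric.mem_ball, Real.dist_eq, sub_zero, abs_of_nonneg hs.1]
    have := hs.2.trans (min_le_right _ _)
    linarith
  have hex : ∀ s ∈ Set.Icc 0 (min s0 (δ / 2)), ∃ y ∈ Metric.closedBall (0 : Fin m → ℝ) r, F s y = 0 := by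
    intro s hs
    obtain ⟨hs1, hs2⟩ := hsmall s hs
    have happ : ApproximatesLinearOn (F s) (ContinuousLinearMap.id ℝ (Fin m → ℝ))
        (Metric.closedBall (0 : Fin m → ℝ) r) (1 / 2) := by
      intro y hy y' hy'
      simpa using hF s hs1 y hy y' hy'
    let inv : (ContinuousLinearMap.id ℝ (Fin m → ℝ)).NonlinearRightInverse :=
      { toFun := id, nnnorm := 1, bound' := by intro y; simp, right_inv' := by intro y; simp }
    have hs := happ.surjOn_closedBall_of_nonlinearRightInverse inv hr.le (b := 0) subset_rfl
    have h0mem : (0 : Fin m → ℝ) ∈ Metric.closedBall (F s 0) (((inv.nnnorm : ℝ)⁻¹ - ((1 / 2 : NNReal) : ℝ)) * r) := by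
      rw [Metric.mem_closedBall, dist_zero_left]
      have : (((inv.nnnorm : ℝ)⁻¹ - ((1 / 2 : NNReal) : ℝ)) * r) = r / 2 := by
        simp [inv]; ring
      rw [this]; exact hs2
    obtain ⟨y, hy, hy'⟩ := hs h0mem
    exact ⟨y, hy, hy'⟩
  choose! y hy hy0 using hex
  refine ⟨min s0 (δ / 2), lt_min hs0 (by positivity), min_le_left _ _, y, ?_, ?_⟩
  · intro t ht
    have hcy := hc (y t) (hy t ht) t (hsmall t ht).1
    rw [ContinuousWithinAt, tendsto_iff_norm_sub_tendsto_zero]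
    have h1 : Tendsto (fun s => 2 * ‖F s (y t) - F t (y t)‖) (𝓝[Set.Icc 0 (min s0 (δ / 2))] t) (𝓝 0) := by
      have := (tendsto_iff_norm_sub_tendsto_zero.1 hcy).const_mul 2
      rw [mul_zero] at this
      exact this.mono_left (nhdsWithin_mono _ (Set.Icc_subset_Icc le_rfl (min_le_left _ _)))
    refine squeeze_zero' (Eventually.of_forall fun _ => norm_nonneg _) ?_ h1
    filter_upwards [self_mem_nhdsWithin] with s hs
    refine (hexp s (hsmall s hs).1 _ (hy s hs) _ (hy t ht)).trans ?_
    rw [hy0 s hs, hy0 t ht, zero_sub, norm_neg, sub_zero]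
  · intro s hs
    refine ⟨hy s hs, hy0 s hs, ?_⟩
    have := hexp s (hsmall s hs).1 _ (hy s hs) 0 hz
    rwa [hy0 s hs, sub_zero, zero_sub, norm_neg] at this

open Heis in
/-- usable local form of the `C¹_ℍ` condition -/
theorem IsC1H.local_data {n m : ℕ} {d : Heis n → Heis n → ℝ} (hd : IsHomDist n d)
    {S : Set (Heis n)} (hS : IsC1H d m S) {p : Heis n} (hp : p ∈ S) :
    ∃ (U : Set (Heis n)) (f : Heis n → Fin m → ℝ) (g : Heis n → Fin m → (Fin n → ℝ) × (Fin n → ℝ)),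
      IsOpen U ∧ p ∈ U ∧ (∀ q ∈ U, ContinuousAt f q) ∧ (∀ q ∈ U, ContinuousAt g q) ∧
      (∀ q ∈ U, (q ∈ S ↔ f q = 0)) ∧
      (∀ q ∈ U, ∀ ε : ℝ, 0 < ε → ∀ᶠ q' in 𝓝 q,
        ‖(fun i => f q' i - f q i - hdot (g q i) (mul (inv q) q') : Fin m → ℝ)‖ ≤ ε * d q q') ∧
      LinearIndependent ℝ (g p) := by
  obtain ⟨U, hU, hpU, f, g, hf, hg, hSU, hP, hli⟩ := hS p hp
  have hUo := hd.isOpen hU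
  have hnh : ∀ q ∈ U, dnhds d U q = 𝓝[≠] q := by
    intro q hq
    rw [hd.dnhds_eq, Set.sdiff_eq, Set.inter_comm, nhdsWithin_inter_of_mem']
    exact nhdsWithin_le_nhds (hUo.mem_nhds hq)
  refine ⟨U, f, g, hUo, hpU, ?_, ?_, ?_, ?_, hli p hpU⟩
  · intro q hq
    have := hf q hq
    rw [hnh q hq] at this
    exact continuousAt_iff_punctured_nhds.2 this
  · intro q hq
    have := hg q hq
    rw [hnh q hq] at this
    exact continuousAt_iff_punctured_nhds.2 this
  · intro q hq
    have : q ∈ S ∩ U ↔ q ∈ U ∧ f q = 0 := by rw [hSU]; exact Iff.rfl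
    exact ⟨fun h => (this.1 ⟨h, hq⟩).2, fun h => (this.2 ⟨hq, h⟩).1⟩
  · intro q hq ε hε
    have h := hP q hq
    rw [hd.dnhds_eq, ← Set.compl_eq_univ_sdiff] at h
    have h1 := h.eventually (gt_mem_nhds hε)
    rw [eventually_nhdsWithin_iff] at h1
    filter_upwards [h1] with q' hq'
    by_cases he : q' = q
    · subst he
      rw [Heis.inv_mul', hd.self, mul_zero]
      have : (fun i => f q' i - f q' i - hdot (g q' i) 0 : Fin m → ℝ) = 0 := by
        ext i; simp [hdot]
      rw [this, norm_zero]
    · have hpos : 0 < d q q' :=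
        lt_of_le_of_ne (hd.nonneg_s17 _ _) fun h0 => he ((hd.eq_iff q q').1 h0.symm).symm
      have := hq' he
      rw [div_lt_iff₀ hpos] at this
      exact this.le

open Heis in
theorem exists_curve {n m : ℕ} (hmn : m ≤ n) {d : Heis n → Heis n → ℝ} (hd : IsHomDist n d)
    {S : Set (Heis n)} {p : Heis n} (hp : p ∈ S)
    {U : Set (Heis n)} {f : Heis n → Fin m → ℝ} {g : Heis n → Fin m → (Fin n → ℝ) × (Fin n → ℝ)}
    (hU : IsOpen U) (hpU : p ∈ U) (hf : ∀ q ∈ U, ContinuousAt f q) (hg : ∀ q ∈ U, ContinuousAt g q)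
    (hSU : ∀ q ∈ U, (q ∈ S ↔ f q = 0))
    (hP : ∀ q ∈ U, ∀ ε : ℝ, 0 < ε → ∀ᶠ q' in 𝓝 q,
        ‖(fun i => f q' i - f q i - hdot (g q i) (mul (inv q) q') : Fin m → ℝ)‖ ≤ ε * d q q')
    (hli : LinearIndependent ℝ (g p)) (x : Heis n) (hx : ∀ i, hdot (g p i) x = 0) :
    ∃ (s0 : ℝ) (c : ℝ → Heis n), 0 < s0 ∧ ContinuousOn c (Set.Icc 0 s0) ∧ c 0 = p ∧
      (∀ s ∈ Set.Icc 0 s0, c s ∈ S) ∧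
      Tendsto (fun s => dil s⁻¹ (mul (inv p) (c s))) (𝓝[>] 0) (𝓝 x) := by
  obtain ⟨B, hBiso, hBg⟩ := exists_isotropic_right_inverse hmn (g p) hli
  have hfp : f p = 0 := (hSU p hpU).1 hp
  -- the embedding
  let b : (Fin m → ℝ) → Heis n := fun y => ((B y).1, (B y).2, 0)
  have hBc : Continuous B := B.continuous_of_finiteDimensional
  have hbc : Continuous b := by
    have h1 : Continuous fun y => (B y).1 := continuous_fst.comp hBc
    have h2 : Continuous fun y => (B y).2 := continuous_snd.comp hBc
    exact h1.prodMk (h2.prodMk continuous_const)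
  have hb0 : b 0 = 0 := by simp [b]
  have hbadd : ∀ y h, b (y + h) = mul (b y) (b h) := by
    intro y h
    refine Prod.ext ?_ (Prod.ext ?_ ?_)
    · simp [b, mul]
    · simp [b, mul]
    · have := hBiso y h
      simp only [b, mul]
      rw [this]; simp
  have hbdil : ∀ (c : ℝ) y, b (c • y) = dil c (b y) := by
    intro c y
    refine Prod.ext ?_ (Prod.ext ?_ ?_) <;> simp [b, dil]
  obtain ⟨C, hC⟩ : ∃ C : ℝ, ∀ h, d 0 (b h) ≤ C * ‖h‖ := by
    obtain ⟨C, hC⟩ := (isCompact_closedBall (0 : Fin m → ℝ) 1).exists_bound_of_continuousOn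
      (hd.continuous_N.comp hbc).continuousOn
    refine ⟨C, fun h => ?_⟩
    rcases eq_or_ne h 0 with rfl | hh
    · rw [hb0, hd.self]; simp
    · have hpos : 0 < ‖h‖ := norm_pos_iff.2 hh
      have e : h = ‖h‖ • (‖h‖⁻¹ • h) := by rw [smul_smul, mul_inv_cancel₀ hpos.ne', one_smul]
      have h1 : ‖d 0 (b (‖h‖⁻¹ • h))‖ ≤ C := hC (‖h‖⁻¹ • h) (by
        rw [mem_closedBall_zero_iff, norm_smul, norm_inv, norm_norm, inv_mul_cancel₀ hpos.ne'])
      conv_lhs => rw [e, hbdil, hd.N_dil _ hpos]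
      rw [mul_comm]
      exact mul_le_mul_of_nonneg_right ((le_abs_self _).trans h1) hpos.le
  -- the derivative
  have hlin : ∀ (v v' : (Fin n → ℝ) × (Fin n → ℝ)) (w : Heis n), hdot (v + v') w = hdot v w + hdot v' w := by
    intro v v' w
    simp only [hdot, Prod.fst_add, Prod.snd_add, Pi.add_apply, add_mul, Finset.sum_add_distrib]; ring
  have hlin' : ∀ (c : ℝ) (v : (Fin n → ℝ) × (Fin n → ℝ)) (w : Heis n), hdot (c • v) w = c * hdot v w := by
    intro c v w
    simp only [hdot, Prod.smul_fst, Prod.smul_snd, Pi.smul_apply, smul_eq_mul, mul_add, Finset.mul_sum, mul_assoc]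
  have hbh : ∀ v y y', hdot v (b (y + y')) = hdot v (b y) + hdot v (b y') := by
    intro v y y'
    simp only [hdot, b, map_add, Prod.fst_add, Prod.snd_add, Pi.add_apply, mul_add, Finset.sum_add_distrib]; ring
  have hbh' : ∀ v (c : ℝ) y, hdot v (b (c • y)) = c * hdot v (b y) := by
    intro v c y
    simp only [hdot, b, map_smul, Prod.smul_fst, Prod.smul_snd, Pi.smul_apply, smul_eq_mul, mul_add, Finset.mul_sum]
    congr 1 <;> exact Finset.sum_congr rfl fun j _ => by ring
  let Φ : (Fin m → (Fin n → ℝ) × (Fin n → ℝ)) →ₗ[ℝ] ((Fin m → ℝ) →L[ℝ] (Fin m → ℝ)) :=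
    { toFun := fun v => LinearMap.toContinuousLinearMap
        { toFun := fun y i => hdot (v i) (b y)
          map_add' := fun y y' => by ext i; exact hbh _ _ _
          map_smul' := fun c y => by ext i; exact hbh' _ _ _ }
      map_add' := fun v v' => by ext y i; exact hlin _ _ _
      map_smul' := fun c v => by ext y i; exact hlin' _ _ _ }
  have hΦ : ∀ v y i, Φ v y i = hdot (v i) (b y) := fun v y i => rfl
  have hΦc : Continuous Φ := Φ.continuous_of_finiteDimensional
  have hΦp : Φ (g p) = ContinuousLinearMap.id ℝ _ := by
    ext1 y
    ext i
    rw [hΦ]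
    exact hBg y i
  let a : ℝ → (Fin m → ℝ) → Heis n := fun s y => mul (mul p (dil s x)) (b y)
  have hac : Continuous (fun w : ℝ × (Fin m → ℝ) => a w.1 w.2) := by
    have h1 : Continuous (fun w : ℝ × (Fin m → ℝ) => mul p (dil w.1 x)) :=
      (hmul_left_cont p).comp (dil_cont.comp (continuous_fst.prodMk continuous_const))
    exact hmul_cont.comp (h1.prodMk (hbc.comp continuous_snd))
  have ha0 : a 0 0 = p := by simp only [a, hb0, mul_zero', zero_dil]
  let F : ℝ → (Fin m → ℝ) → (Fin m → ℝ) := fun s y => f (a s y)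
  have hderiv : ∀ s y, a s y ∈ U → HasFDerivAt (F s) (Φ (g (a s y))) y := by
    intro s y hq
    rw [hasFDerivAt_iff_isLittleO_nhds_zero, Asymptotics.isLittleO_iff]
    intro ε hε
    have hC0 : 0 < |C| + 1 := by positivity
    have h1 := hP _ hq (ε / (|C| + 1)) (by positivity)
    have h2 : Tendsto (fun h => a s (y + h)) (𝓝 0) (𝓝 (a s y)) := by
      have : Continuous fun h => a s (y + h) :=
        hac.comp (continuous_const.prodMk (continuous_const.add continuous_id))
      have := this.tendsto 0
      rwa [add_zero] at this
    filter_upwards [h2.eventually h1] with h hh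
    have e : mul (inv (a s y)) (a s (y + h)) = b h := by
      simp only [a]
      rw [hbadd, ← mul_assoc' _ (b y) (b h), inv_mul_cancel']
    rw [hd.eq_N, e] at hh
    have e2 : (fun i => f (a s (y + h)) i - f (a s y) i - hdot (g (a s y) i) (b h) : Fin m → ℝ)
      = F s (y + h) - F s y - Φ (g (a s y)) h := by
      ext i; rfl
    rw [e2] at hh
    refine hh.trans ?_
    calc ε / (|C| + 1) * d 0 (b h) ≤ ε / (|C| + 1) * ((|C| + 1) * ‖h‖) := by
          refine mul_le_mul_of_nonneg_left ((hC h).trans ?_) (by positivity)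
          exact mul_le_mul_of_nonneg_right ((le_abs_self C).trans (by linarith)) (norm_nonneg _)
      _ = ε * ‖h‖ := by field_simp
  obtain ⟨r, s0, hr, hs0, hrs⟩ : ∃ r s0 : ℝ, 0 < r ∧ 0 < s0 ∧ ∀ s ∈ Set.Icc 0 s0,
      ∀ y ∈ Metric.closedBall (0 : Fin m → ℝ) r, a s y ∈ U ∧
        ‖Φ (g (a s y)) - ContinuousLinearMap.id ℝ _‖ ≤ 1 / 2 := by
    have h1 : ∀ᶠ q in 𝓝 p, q ∈ U ∧ ‖Φ (g q) - ContinuousLinearMap.id ℝ _‖ ≤ 1 / 2 := by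
      refine Filter.Eventually.and (hU.mem_nhds hpU) ?_
      have h2 : ContinuousAt (fun q => ‖Φ (g q) - ContinuousLinearMap.id ℝ _‖) p :=
        ((hΦc.continuousAt.comp (hg p hpU)).sub continuousAt_const).norm
      have h3 : ‖Φ (g p) - ContinuousLinearMap.id ℝ _‖ < 1 / 2 := by
        rw [hΦp, sub_self, norm_zero]; norm_num
      filter_upwards [h2.eventually (gt_mem_nhds h3)] with q hq using hq.le
    have h2 : ∀ᶠ w in 𝓝 ((0 : ℝ), (0 : Fin m → ℝ)), a w.1 w.2 ∈ U ∧
        ‖Φ (g (a w.1 w.2)) - ContinuousLinearMap.id ℝ _‖ ≤ 1 / 2 := by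
      have := hac.tendsto ((0 : ℝ), (0 : Fin m → ℝ))
      simp only [ha0] at this
      exact this.eventually h1
    obtain ⟨δ, hδ, hδs⟩ := Metric.mem_nhds_iff.1 h2
    refine ⟨δ / 2, δ / 2, by positivity, by positivity, fun s hs y hy => ?_⟩
    refine hδs (a := (s, y)) ?_
    rw [Metric.mem_ball, Prod.dist_eq]
    refine max_lt ?_ ?_
    · change dist s 0 < δ
      rw [Real.dist_eq, sub_zero, abs_of_nonneg hs.1]; linarith [hs.2]
    · change dist y 0 < δ
      rw [Metric.mem_closedBall] at hy; linarith
  obtain ⟨s1, hs1, hs10, y, hyc, hy⟩ := implicit_curve F r s0 hr hs0 (by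
      intro s hs y hy y' hy'
      have := (convex_closedBall (0 : Fin m → ℝ) r).norm_image_sub_le_of_norm_hasFDerivWithin_le'
        (f := F s) (f' := fun y => Φ (g (a s y))) (φ := ContinuousLinearMap.id ℝ _) (C := 1 / 2)
        (fun z hz => (hderiv s z (hrs s hs z hz).1).hasFDerivWithinAt)
        (fun z hz => (hrs s hs z hz).2) hy' hy
      simpa using this)
    (by
      intro y hy s hs
      have h1 : ContinuousAt (fun s => a s y) s :=
        (hac.comp (continuous_id.prodMk continuous_const)).continuousAt
      exact (ContinuousAt.comp (f := fun s => a s y) (hf _ (hrs s hs y hy).1) h1).continuousWithinAt)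
    (by change f (a 0 0) = 0; rw [ha0, hfp])
  have hsub : ∀ s ∈ Set.Icc 0 s1, s ∈ Set.Icc 0 s0 := fun s hs => ⟨hs.1, hs.2.trans hs10⟩
  have hy00 : y 0 = 0 := by
    have := (hy 0 ⟨le_rfl, hs1.le⟩).2.2
    have e : F 0 0 = 0 := by change f (a 0 0) = 0; rw [ha0, hfp]
    rw [e, norm_zero, mul_zero] at this
    exact norm_le_zero_iff.1 this
  refine ⟨s1, fun s => a s (y s), hs1, ?_, ?_, ?_, ?_⟩
  · exact hac.comp_continuousOn (continuousOn_id.prodMk hyc)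
  · change a 0 (y 0) = p
    rw [hy00, ha0]
  · intro s hs
    exact (hSU _ (hrs s (hsub s hs) _ (hy s hs).1).1).2 (hy s hs).2.1
  · have hkey : Tendsto (fun s : ℝ => s⁻¹ • y s) (𝓝[>] 0) (𝓝 0) := by
      rw [Metric.tendsto_nhds]
      intro ε hε
      have hN : 0 < d 0 x + 1 := by linarith [hd.nonneg_s17 0 x]
      have h1 := hP p hpU (ε / 4 / (d 0 x + 1)) (by positivity)
      have h2 : Tendsto (fun s : ℝ => a s 0) (𝓝[>] 0) (𝓝 p) := by
        have h9 : Continuous fun s : ℝ => a s 0 := hac.comp (continuous_id.prodMk continuous_const)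
        have := h9.tendsto 0
        rw [ha0] at this
        exact this.mono_left nhdsWithin_le_nhds
      have h3 : ∀ᶠ s in 𝓝[>] (0 : ℝ), s ∈ Set.Ioc 0 s1 := Ioc_mem_nhdsGT hs1
      filter_upwards [h2.eventually h1, h3] with s hs hs3
      have hspos : 0 < s := hs3.1
      have e1 : mul (inv p) (a s 0) = dil s x := by
        simp only [a, hb0, mul_zero', inv_mul_cancel']
      have e2 : ∀ i, hdot (g p i) (dil s x) = 0 := by
        intro i
        have : hdot (g p i) (dil s x) = s * hdot (g p i) x := by
          simp only [hdot, dil, Pi.smul_apply, smul_eq_mul, mul_add, Finset.mul_sum]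
          congr 1 <;> exact Finset.sum_congr rfl fun j _ => by ring
        rw [this, hx, mul_zero]
      rw [hd.eq_N p, e1, hd.N_dil s hspos] at hs
      have e3 : (fun i => f (a s 0) i - f p i - hdot (g p i) (dil s x) : Fin m → ℝ) = F s 0 := by
        ext i
        rw [e2, hfp]; simp [F]
      rw [e3] at hs
      have h4 := (hy s ⟨hs3.1.le, hs3.2⟩).2.2
      rw [dist_zero_right, norm_smul, norm_inv, Real.norm_eq_abs, abs_of_pos hspos,
        inv_mul_lt_iff₀ hspos]
      have h5 : ε / 4 / (d 0 x + 1) * (s * d 0 x) ≤ ε / 4 * s := by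
        rw [div_mul_eq_mul_div, div_le_iff₀ hN]
        have : 0 ≤ ε / 4 * s := by positivity
        nlinarith
      have : 0 < s * ε := by positivity
      linarith
    have h6 : Tendsto (fun s : ℝ => mul x (b (s⁻¹ • y s))) (𝓝[>] 0) (𝓝 x) := by
      have h7 : Tendsto (fun z => mul x (b z)) (𝓝 0) (𝓝 x) := by
        have := ((hmul_left_cont x).comp hbc).tendsto 0
        simp only [Function.comp, hb0, mul_zero'] at this
        exact this
      exact h7.comp hkey
    refine h6.congr' ?_
    filter_upwards [self_mem_nhdsWithin] with s hs
    have hspos : (0 : ℝ) < s := hs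
    simp only [a]
    rw [mul_assoc', inv_mul_cancel', dil_mul, dil_dil, inv_mul_cancel₀ hspos.ne', dil_one, hbdil]

open Heis in
theorem hdot_dil {n : ℕ} (v : (Fin n → ℝ) × (Fin n → ℝ)) (c : ℝ) (w : Heis n) :
    hdot v (dil c w) = c * hdot v w := by
  simp only [hdot, dil, Pi.smul_apply, smul_eq_mul, mul_add, Finset.mul_sum]
  congr 1 <;> exact Finset.sum_congr rfl fun j _ => by ring

open Heis in
theorem hdot_mul {n : ℕ} (v : (Fin n → ℝ) × (Fin n → ℝ)) (w w' : Heis n) :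
    hdot v (mul w w') = hdot v w + hdot v w' := by
  simp only [hdot, mul, Pi.add_apply, mul_add, Finset.sum_add_distrib]; ring

open Heis in
theorem hdot_cont {n : ℕ} (v : (Fin n → ℝ) × (Fin n → ℝ)) :
    Continuous (fun w : Heis n => hdot v w) := by
  unfold hdot; fun_prop

open Heis in
theorem tangent_iff {n m : ℕ} (hmn : m ≤ n) {d : Heis n → Heis n → ℝ} (hd : IsHomDist n d)
    {S : Set (Heis n)} {p : Heis n} (hp : p ∈ S)
    {U : Set (Heis n)} {f : Heis n → Fin m → ℝ} {g : Heis n → Fin m → (Fin n → ℝ) × (Fin n → ℝ)}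
    (hU : IsOpen U) (hpU : p ∈ U) (hf : ∀ q ∈ U, ContinuousAt f q) (hg : ∀ q ∈ U, ContinuousAt g q)
    (hSU : ∀ q ∈ U, (q ∈ S ↔ f q = 0))
    (hP : ∀ q ∈ U, ∀ ε : ℝ, 0 < ε → ∀ᶠ q' in 𝓝 q,
        ‖(fun i => f q' i - f q i - hdot (g q i) (mul (inv q) q') : Fin m → ℝ)‖ ≤ ε * d q q')
    (hli : LinearIndependent ℝ (g p)) {T : Set (Heis n)}
    (hT : KurFam (fun lam => (fun q => Heis.dil lam (Heis.mul (Heis.inv p) q)) '' S) T) (x : Heis n) :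
    x ∈ T ↔ ∀ i, hdot (g p i) x = 0 := by
  constructor
  · intro hx i
    have hlam : Tendsto (fun j : ℕ => (j : ℝ) + 1) atTop atTop :=
      tendsto_atTop_add_const_right _ _ tendsto_natCast_atTop_atTop
    obtain ⟨z, hz, hzx⟩ := hT.1 x hx _ hlam
    choose q hqS hq using hz
    have hpos : ∀ j : ℕ, (0 : ℝ) < (j : ℝ) + 1 := fun j => by positivity
    have hq1 : ∀ j, mul (inv p) (q j) = dil ((j : ℝ) + 1)⁻¹ (z j) := by
      intro j
      rw [← hq j]
      simp only [dil_dil]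
      rw [inv_mul_cancel₀ (hpos j).ne', dil_one]
    have hq2 : ∀ j, q j = mul p (dil ((j : ℝ) + 1)⁻¹ (z j)) := by
      intro j
      rw [← hq1, mul_inv_cancel']
    have hqp : Tendsto q atTop (𝓝 p) := by
      have h1 : Tendsto (fun j : ℕ => dil ((j : ℝ) + 1)⁻¹ (z j)) atTop (𝓝 (dil 0 x)) :=
        (dil_cont.tendsto (0, x)).comp ((tendsto_inv_atTop_zero.comp hlam).prodMk_nhds hzx)
      have h2 := ((hmul_left_cont p).tendsto _).comp h1
      rw [zero_dil, mul_zero'] at h2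
      refine h2.congr fun j => ?_
      simp only [Function.comp, ← hq2]
    have hfp : f p = 0 := (hSU p hpU).1 hp
    have hbound : ∀ ε : ℝ, 0 < ε → |hdot (g p i) x| ≤ ε * d 0 x := by
      intro ε hε
      have l1 : Tendsto (fun j => |hdot (g p i) (z j)|) atTop (𝓝 |hdot (g p i) x|) :=
        (((hdot_cont (g p i)).tendsto x).comp hzx).abs
      have l2 : Tendsto (fun j => ε * d 0 (z j)) atTop (𝓝 (ε * d 0 x)) :=
        ((hd.continuous_N.tendsto x).comp hzx).const_mul ε
      refine le_of_tendsto_of_tendsto l1 l2 ?_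
      filter_upwards [hqp.eventually (hP p hpU ε hε), hqp.eventually (hU.mem_nhds hpU)] with j hj hjU
      have hfq : f (q j) = 0 := (hSU _ hjU).1 (hqS j)
      have h3 := (norm_le_pi_norm _ i).trans hj
      rw [hfq, hfp, hd.eq_N p, hq1, hd.N_dil _ (inv_pos.2 (hpos j)), hdot_dil] at h3
      simp only [Pi.zero_apply, sub_self, zero_sub, norm_neg, Real.norm_eq_abs, abs_mul,
        abs_of_pos (inv_pos.2 (hpos j))] at h3
      rw [mul_left_comm] at h3
      exact le_of_mul_le_mul_left h3 (inv_pos.2 (hpos j))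
    by_contra hne
    have hab : 0 < |hdot (g p i) x| := abs_pos.2 hne
    have hN : 0 < d 0 x + 1 := by linarith [hd.nonneg_s17 0 x]
    have := hbound (|hdot (g p i) x| / 2 / (d 0 x + 1)) (by positivity)
    rw [div_mul_eq_mul_div, le_div_iff₀ hN] at this
    nlinarith [hd.nonneg_s17 0 x]
  · intro hx
    obtain ⟨s0, c, hs0, hc, hc0, hcS, hlim⟩ := exists_curve hmn hd hp hU hpU hf hg hSU hP hli x hx
    have hlam : Tendsto (fun j : ℕ => (j : ℝ) + s0⁻¹) atTop atTop :=
      tendsto_atTop_add_const_right _ _ tendsto_natCast_atTop_atTop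
    have hinv : Tendsto (fun j : ℕ => ((j : ℝ) + s0⁻¹)⁻¹) atTop (𝓝[>] 0) :=
      tendsto_inv_atTop_nhdsGT_zero.comp hlam
    refine hT.2 (fun j : ℕ => (j : ℝ) + s0⁻¹)
      (fun j : ℕ => dil ((j : ℝ) + s0⁻¹) (mul (inv p) (c ((j : ℝ) + s0⁻¹)⁻¹))) x hlam ?_ ?_
    · intro j
      refine ⟨_, hcS _ ⟨by positivity, ?_⟩, rfl⟩
      refine inv_le_of_inv_le₀ hs0 ?_
      have : (0 : ℝ) ≤ j := Nat.cast_nonneg j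
      linarith
    · have := hlim.comp hinv
      simpa only [Function.comp_def, inv_inv] using this

/-- McShane extension for a general distance function. -/
theorem exists_lipschitz_extension {α : Type*} (d : α → α → ℝ) (h0 : ∀ x, d x x = 0)
    (hs : ∀ x y, d x y = d y x) (ht : ∀ x y z, d x z ≤ d x y + d y z) {ℓ : ℕ} (S : Set α)
    (u : α → Fin ℓ → ℝ) (C : ℝ) (hu : ∀ a ∈ S, ∀ b ∈ S, ‖u a - u b‖ ≤ C * d a b) :
    ∃ tu : α → Fin ℓ → ℝ, (∀ q ∈ S, tu q = u q) ∧ ∃ C : ℝ, ∀ a b, ‖tu a - tu b‖ ≤ C * d a b := by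
  let _ : PseudoMetricSpace α :=
    { dist := d
      dist_self := h0
      dist_comm := hs
      dist_triangle := ht }
  have hdd : ∀ a b : α, dist a b = d a b := fun _ _ => rfl
  have hL : LipschitzOnWith (Real.toNNReal |C|) u S := by
    refine LipschitzOnWith.of_dist_le_mul fun a ha b hb => ?_
    rw [dist_eq_norm, Real.coe_toNNReal _ (abs_nonneg C)]
    exact (hu a ha b hb).trans (mul_le_mul_of_nonneg_right (le_abs_self C) (by rw [← hdd]; exact dist_nonneg))
  obtain ⟨tu, htu, he⟩ := hL.extend_pi
  refine ⟨tu, fun q hq => (he hq).symm, Real.toNNReal |C|, fun a b => ?_⟩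
  rw [← dist_eq_norm]
  exact htu.dist_le_mul a b

open Heis in
theorem equi_lip {n ℓ : ℕ} {d : Heis n → Heis n → ℝ} (hd : IsHomDist n d) (p : Heis n)
    (tu : Heis n → Fin ℓ → ℝ) (C : ℝ) (h : ∀ a b, ‖tu a - tu b‖ ≤ C * d a b) (lam : ℝ) (hl : 0 < lam)
    (x y : Heis n) :
    ‖lam • (tu (mul p (dil lam⁻¹ x)) - tu p) - lam • (tu (mul p (dil lam⁻¹ y)) - tu p)‖ ≤ C * d x y := by
  rw [← smul_sub, sub_sub_sub_cancel_right, norm_smul, Real.norm_eq_abs, abs_of_pos hl]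
  have := h (mul p (dil lam⁻¹ x)) (mul p (dil lam⁻¹ y))
  rw [hd.leftInv, hd.homog _ (inv_pos.2 hl)] at this
  calc _ ≤ lam * (C * (lam⁻¹ * d x y)) := mul_le_mul_of_nonneg_left this hl.le
    _ = C * d x y := by field_simp

open Heis in
theorem locally_uniform_of_pointwise {n ℓ : ℕ} {d : Heis n → Heis n → ℝ} (hd : IsHomDist n d)
    (F : ℝ → Heis n → Fin ℓ → ℝ) (L : Heis n → Fin ℓ → ℝ) (T : Set (Heis n)) (C : ℝ)
    (hF : ∀ lam, 0 < lam → ∀ x y, ‖F lam x - F lam y‖ ≤ C * d x y)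
    (hpt : ∀ x ∈ T, Tendsto (fun lam => F lam x) atTop (𝓝 (L x))) :
    TendstoLocallyUniformlyOn F L atTop T := by
  have hL : ∀ x ∈ T, ∀ y ∈ T, ‖L x - L y‖ ≤ C * d x y := by
    intro x hx y hy
    refine le_of_tendsto ((hpt x hx).sub (hpt y hy)).norm ?_
    filter_upwards [eventually_gt_atTop 0] with lam hl using hF lam hl x y
  rw [Metric.tendstoLocallyUniformlyOn_iff]
  intro ε hε x hx
  have h1 : ∀ᶠ y in 𝓝[T] x, C * d x y < ε / 3 := by
    have h2 : Tendsto (fun y => C * d x y) (𝓝 x) (𝓝 0) := by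
      simpa using (hd.tendsto_d x).const_mul C
    exact (h2.eventually (gt_mem_nhds (by positivity))).filter_mono nhdsWithin_le_nhds
  refine ⟨{y | y ∈ T ∧ C * d x y < ε / 3}, ?_, ?_⟩
  · filter_upwards [h1, self_mem_nhdsWithin] with y hy hyT using ⟨hyT, hy⟩
  · have h3 := (Metric.tendsto_nhds.1 (hpt x hx)) (ε / 3) (by positivity)
    filter_upwards [h3, eventually_gt_atTop 0] with lam h4 hl y hy
    rw [dist_eq_norm] at h4 ⊢
    have e : L y - F lam y = (L y - L x) + (L x - F lam x) + (F lam x - F lam y) := by abel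
    rw [e]
    have a1 := hL x hx y hy.1
    have a2 := hF lam hl x y
    rw [norm_sub_rev] at a1 h4
    have a3 := norm_add₃_le (a := L y - L x) (b := L x - F lam x) (c := F lam x - F lam y)
    linarith [hy.2]

open Heis in
theorem forward_pointwise {n m ℓ : ℕ} (hmn : m ≤ n) {d : Heis n → Heis n → ℝ} (hd : IsHomDist n d)
    {S : Set (Heis n)} {p : Heis n} (hp : p ∈ S)
    {U : Set (Heis n)} {f : Heis n → Fin m → ℝ} {g : Heis n → Fin m → (Fin n → ℝ) × (Fin n → ℝ)}
    (hU : IsOpen U) (hpU : p ∈ U) (hf : ∀ q ∈ U, ContinuousAt f q) (hg : ∀ q ∈ U, ContinuousAt g q)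
    (hSU : ∀ q ∈ U, (q ∈ S ↔ f q = 0))
    (hP : ∀ q ∈ U, ∀ ε : ℝ, 0 < ε → ∀ᶠ q' in 𝓝 q,
        ‖(fun i => f q' i - f q i - hdot (g q i) (mul (inv q) q') : Fin m → ℝ)‖ ≤ ε * d q q')
    (hli : LinearIndependent ℝ (g p))
    (Lt : Heis n → Fin ℓ → ℝ) (hLt : ∀ a b : Heis n, Lt (Heis.mul a b) = Lt a + Lt b)
    (hLtc : ∀ t : ℝ, Lt (0, 0, t) = 0)
    (tu : Heis n → Fin ℓ → ℝ) (C : ℝ) (hC : ∀ a b, ‖tu a - tu b‖ ≤ C * d a b)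
    (hdiff : ∀ ε : ℝ, 0 < ε → ∀ᶠ q in 𝓝 p, q ∈ S → ‖tu q - tu p - Lt (mul (inv p) q)‖ ≤ ε * d p q)
    (x : Heis n) (hx : ∀ i, hdot (g p i) x = 0) :
    Tendsto (fun lam : ℝ => lam • (tu (mul p (dil lam⁻¹ x)) - tu p)) atTop (𝓝 (Lt x)) := by
  obtain ⟨s0, c, hs0, hc, hc0, hcS, hlim⟩ := exists_curve hmn hd hp hU hpU hf hg hSU hP hli x hx
  let A : (Fin n → ℝ) × (Fin n → ℝ) → Fin ℓ → ℝ := fun v => Lt (v.1, v.2, 0)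
  have hLtA : ∀ w : Heis n, Lt w = A (w.1, w.2.1) := by
    intro w
    have e : w = mul (w.1, w.2.1, 0) (0, 0, w.2.2) := by
      refine Prod.ext ?_ (Prod.ext ?_ ?_) <;> simp [mul]
    conv_lhs => rw [e, hLt, hLtc, add_zero]
  have hA : ∀ v w, A (v + w) = A v + A w := by
    intro v w
    have h1 := hLt (v.1, v.2, 0) (w.1, w.2, 0)
    rw [hLtA (mul _ _)] at h1
    exact h1
  have hcp : Tendsto c (𝓝[Set.Icc 0 s0] 0) (𝓝 p) := by
    have := hc 0 ⟨le_rfl, hs0.le⟩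
    rwa [ContinuousWithinAt, hc0] at this
  let γ0 : ℝ → (Fin n → ℝ) × (Fin n → ℝ) := fun s =>
    ((mul (inv p) (c s)).1, (mul (inv p) (c s)).2.1)
  have hπ : Continuous (fun w : Heis n => ((w.1, w.2.1) : (Fin n → ℝ) × (Fin n → ℝ))) := by fun_prop
  have hγ0c : ContinuousOn γ0 (Set.Icc 0 s0) :=
    (hπ.comp (hmul_left_cont (inv p))).comp_continuousOn hc
  have hbd : ∀ᶠ s in 𝓝[Set.Icc 0 s0] (0 : ℝ), s ∈ Set.Icc 0 s0 → ‖A (γ0 s)‖ ≤ 1 + |C| := by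
    filter_upwards [hcp.eventually (hdiff 1 one_pos),
      hcp.eventually ((hd.tendsto_d p).eventually (gt_mem_nhds one_pos))] with s h1 h2 hs
    have h3 := h1 (hcS s hs)
    have h4 : A (γ0 s) = (tu (c s) - tu p) - (tu (c s) - tu p - Lt (mul (inv p) (c s))) := by
      rw [sub_sub_cancel, hLtA]
    rw [h4]
    have h5 := hC (c s) p
    rw [hd.symm] at h5
    have h6 := hd.nonneg_s17 p (c s)
    refine (norm_sub_le _ _).trans ?_
    nlinarith [le_abs_self C, abs_nonneg C]
  obtain ⟨δ, hδ, hδs⟩ := Metric.mem_nhdsWithin_iff.1 hbd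
  set s1 := min s0 (δ / 2) with hs1def
  have hs1 : 0 < s1 := lt_min hs0 (by positivity)
  have hs10 : s1 ≤ s0 := min_le_left _ _
  have hbd1 : ∀ s ∈ Set.Icc 0 s1, ‖A (γ0 s)‖ ≤ 1 + |C| := by
    intro s hs
    have hs' : s ∈ Set.Icc 0 s0 := ⟨hs.1, hs.2.trans hs10⟩
    refine hδs ⟨?_, hs'⟩ hs'
    rw [Metric.mem_ball, Real.dist_eq, sub_zero, abs_of_nonneg hs.1]
    have := hs.2.trans (min_le_right _ _)
    linarith
  have hresc : ∀ σ ∈ Set.Icc (0 : ℝ) 1, s1 * σ ∈ Set.Icc 0 s1 := fun σ hσ =>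
    ⟨mul_nonneg hs1.le hσ.1, mul_le_of_le_one_right hs1.le hσ.2⟩
  obtain ⟨B, hB⟩ := additive_linear_on_curve A hA (fun σ => γ0 (s1 * σ))
    (hγ0c.comp (by fun_prop) (fun σ hσ => ⟨(hresc σ hσ).1, (hresc σ hσ).2.trans hs10⟩))
    (by simp only [mul_zero, γ0, hc0, Heis.inv_mul']; rfl) (1 + |C|) (fun σ hσ => hbd1 _ (hresc σ hσ))
  set X := Submodule.span ℝ ((fun σ => γ0 (s1 * σ)) '' Set.Icc (0 : ℝ) 1) with hX
  have hmem : ∀ s ∈ Set.Icc 0 s1, γ0 s ∈ X := by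
    intro s hs
    refine Submodule.subset_span ⟨s / s1, ⟨div_nonneg hs.1 hs1.le, (div_le_one hs1).2 hs.2⟩, ?_⟩
    simp only [mul_div_cancel₀ s hs1.ne']
  have hsmall : ∀ᶠ s in 𝓝[>] (0 : ℝ), s ∈ Set.Ioc 0 s1 := Ioc_mem_nhdsGT hs1
  -- projections of the blow-ups
  have hz : ∀ s : ℝ, ((dil s⁻¹ (mul (inv p) (c s))).1, (dil s⁻¹ (mul (inv p) (c s))).2.1) = s⁻¹ • γ0 s :=
    fun s => rfl
  have hlimπ : Tendsto (fun s => s⁻¹ • γ0 s) (𝓝[>] 0) (𝓝 (x.1, x.2.1)) :=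
    (hπ.tendsto x).comp hlim
  have hxX : (x.1, x.2.1) ∈ X := by
    have hXc : IsClosed (X : Set ((Fin n → ℝ) × (Fin n → ℝ))) := X.closed_of_finiteDimensional
    refine hXc.mem_of_tendsto hlimπ ?_
    filter_upwards [hsmall] with s hs
    exact X.smul_mem _ (hmem s ⟨hs.1.le, hs.2⟩)
  have hBlim : Tendsto (fun s => s⁻¹ • Lt (mul (inv p) (c s))) (𝓝[>] 0) (𝓝 (Lt x)) := by
    have h1 := ((B.continuous_of_finiteDimensional).tendsto (x.1, x.2.1)).comp hlimπ
    rw [← hB _ hxX, ← hLtA] at h1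
    refine h1.congr' ?_
    filter_upwards [hsmall] with s hs
    simp only [Function.comp]
    rw [map_smul, ← hB _ (hmem s ⟨hs.1.le, hs.2⟩), hLtA (mul _ _)]
  have hcp' : Tendsto c (𝓝[>] 0) (𝓝 p) := by
    refine hcp.mono_left ?_
    rw [← nhdsWithin_Ioc_eq_nhdsGT hs0]
    exact nhdsWithin_mono _ Set.Ioc_subset_Icc_self
  have hNlim : Tendsto (fun s => d 0 (dil s⁻¹ (mul (inv p) (c s)))) (𝓝[>] 0) (𝓝 (d 0 x)) :=
    (hd.continuous_N.tendsto x).comp hlim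
  have herr : Tendsto (fun s => s⁻¹ • (tu (c s) - tu p) - s⁻¹ • Lt (mul (inv p) (c s))) (𝓝[>] 0) (𝓝 0) := by
    rw [Metric.tendsto_nhds]
    intro ε hε
    have hN : 0 < d 0 x + 1 := by linarith [hd.nonneg_s17 0 x]
    have hb := hNlim.eventually (gt_mem_nhds (lt_add_one (d 0 x)))
    filter_upwards [hcp'.eventually (hdiff (ε / 2 / (d 0 x + 1)) (by positivity)), hb, hsmall] with s h1 h2 hs
    have h3 := h1 (hcS s ⟨hs.1.le, hs.2.trans hs10⟩)
    have hspos : 0 < s⁻¹ := inv_pos.2 hs.1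
    rw [hd.N_dil _ hspos, ← hd.eq_N] at h2
    rw [dist_zero_right, ← smul_sub, norm_smul, Real.norm_eq_abs, abs_of_pos hspos]
    calc s⁻¹ * ‖tu (c s) - tu p - Lt (mul (inv p) (c s))‖
        ≤ s⁻¹ * (ε / 2 / (d 0 x + 1) * d p (c s)) := mul_le_mul_of_nonneg_left h3 hspos.le
      _ = ε / 2 / (d 0 x + 1) * (s⁻¹ * d p (c s)) := by ring
      _ ≤ ε / 2 / (d 0 x + 1) * (d 0 x + 1) := mul_le_mul_of_nonneg_left h2.le (by positivity)
      _ = ε / 2 := by field_simp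
      _ < ε := by linarith
  have hmain : Tendsto (fun s => s⁻¹ • (tu (c s) - tu p)) (𝓝[>] 0) (𝓝 (Lt x)) := by
    have := herr.add hBlim
    simpa using this
  have hdz : Tendsto (fun s => d x (dil s⁻¹ (mul (inv p) (c s)))) (𝓝[>] 0) (𝓝 0) :=
    (hd.tendsto_d x).comp hlim
  have hdiff2 : Tendsto (fun s => s⁻¹ • (tu (mul p (dil s x)) - tu p) - s⁻¹ • (tu (c s) - tu p))
      (𝓝[>] 0) (𝓝 0) := by
    have h1 : Tendsto (fun s => C * d x (dil s⁻¹ (mul (inv p) (c s)))) (𝓝[>] 0) (𝓝 0) := by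
      simpa using hdz.const_mul C
    rw [tendsto_zero_iff_norm_tendsto_zero]
    refine squeeze_zero' (Eventually.of_forall fun _ => norm_nonneg _) ?_ h1
    filter_upwards [hsmall] with s hs
    have h2 := equi_lip hd p tu C hC s⁻¹ (inv_pos.2 hs.1) x (dil s⁻¹ (mul (inv p) (c s)))
    rw [inv_inv, dil_dil, mul_inv_cancel₀ hs.1.ne', dil_one, mul_inv_cancel'] at h2
    exact h2
  have hfin : Tendsto (fun s => s⁻¹ • (tu (mul p (dil s x)) - tu p)) (𝓝[>] 0) (𝓝 (Lt x)) := by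
    have := hdiff2.add hmain
    simpa using this
  have := hfin.comp tendsto_inv_atTop_nhdsGT_zero
  simpa only [Function.comp_def, inv_inv] using this

/-- for a Lipschitz `u` on a `C¹_ℍ` submanifold `S` of codimension `m ≤ n`,
`p ∈ S`, and a homogeneous morphism `L : T^ℍ_p S → ℝ^ℓ`, tangential Pansu differentiability
of `u` at `p` with differential `L` is equivalent to: for every Lipschitz extension `ũ` of
`u`, the maps `x ↦ λ(ũ(p δ_{1/λ} x) - ũ(p))` converge to `L` locally uniformly on
`T^ℍ_p S` as `λ → ∞`. -/
theorem tangential_differentiability_iff_extension_differentiable_on_tangent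
    {n m ℓ : ℕ} (hmn : m ≤ n)
    (d : Heis n → Heis n → ℝ) (hd : IsHomDist n d)
    (S : Set (Heis n)) (hS : IsC1H d m S) (p : Heis n) (hp : p ∈ S)
    (T : Set (Heis n))
    (hT : KurFam (fun lam => (fun q => Heis.dil lam (Heis.mul (Heis.inv p) q)) '' S) T)
    (L : Heis n → Fin ℓ → ℝ)
    (hLadd : ∀ w ∈ T, ∀ w' ∈ T, L (Heis.mul w w') = L w + L w')
    (hLhom : ∀ c : ℝ, 0 < c → ∀ w ∈ T, L (Heis.dil c w) = c • L w)
    (u : Heis n → Fin ℓ → ℝ)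
    (hu : ∃ C : ℝ, ∀ a ∈ S, ∀ b ∈ S, ‖u a - u b‖ ≤ C * d a b) :
    TangPansuDiff d S T u p L ↔
      ∀ tu : Heis n → Fin ℓ → ℝ, (∀ q ∈ S, tu q = u q) →
        (∃ C : ℝ, ∀ a b : Heis n, ‖tu a - tu b‖ ≤ C * d a b) →
        TendstoLocallyUniformlyOn
          (fun (lam : ℝ) x => lam • (tu (Heis.mul p (Heis.dil lam⁻¹ x)) - tu p))
          L atTop T := by
  obtain ⟨U, f, g, hU, hpU, hf, hg, hSU, hP, hli⟩ := hS.local_data hd hp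
  have hTiff := tangent_iff hmn hd hp hU hpU hf hg hSU hP hli hT
  have hTc : ∀ t : ℝ, ((0, 0, t) : Heis n) ∈ T := by
    intro t
    rw [hTiff]
    intro i
    simp [Heis.hdot]
  have hLc : ∀ t : ℝ, L (0, 0, t) = 0 := by
    intro t
    have h1 := hLhom 2 two_pos _ (hTc t)
    have e1 : Heis.dil 2 ((0, 0, t) : Heis n) = (0, 0, 4 * t) := by
      refine Prod.ext ?_ (Prod.ext ?_ ?_)
      · simp [Heis.dil]
      · simp [Heis.dil]
      · simp [Heis.dil]; norm_num
    have h2 : ∀ a b : ℝ, L (0, 0, a + b) = L (0, 0, a) + L (0, 0, b) := by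
      intro a b
      rw [← hLadd _ (hTc a) _ (hTc b)]
      congr 1
      refine Prod.ext ?_ (Prod.ext ?_ ?_) <;> simp [Heis.mul]
    have e2 : L (0, 0, 4 * t) = (4 : ℝ) • L (0, 0, t) := by
      have : 4 * t = t + t + (t + t) := by ring
      rw [this, h2, h2]
      ext i; simp; ring
    rw [e1, e2] at h1
    ext i
    have := congrFun h1 i
    simp at this
    simp
    linarith
  have hL0 : L 0 = 0 := hLc 0
  have hLproj : ∀ w ∈ T, ((w.1, w.2.1, 0) : Heis n) ∈ T ∧ L w = L (w.1, w.2.1, 0) := by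
    intro w hw
    have hmem : ((w.1, w.2.1, 0) : Heis n) ∈ T := by
      rw [hTiff] at hw ⊢
      exact hw
    refine ⟨hmem, ?_⟩
    have e : w = Heis.mul (w.1, w.2.1, 0) (0, 0, w.2.2) := by
      refine Prod.ext ?_ (Prod.ext ?_ ?_) <;> simp [Heis.mul]
    conv_lhs => rw [e, hLadd _ hmem _ (hTc _), hLc, add_zero]
  constructor
  · rintro ⟨Lt, hLt, hLtL, hlim⟩ tu htu ⟨C, hC⟩
    have hLtc : ∀ t : ℝ, Lt (0, 0, t) = 0 := fun t => by rw [hLtL _ (hTc t), hLc]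
    have hdiff : ∀ ε : ℝ, 0 < ε → ∀ᶠ q in 𝓝 p, q ∈ S →
        ‖tu q - tu p - Lt (Heis.mul (Heis.inv p) q)‖ ≤ ε * d p q := by
      intro ε hε
      rw [hd.dnhds_eq] at hlim
      have h1 := hlim.eventually (gt_mem_nhds hε)
      rw [eventually_nhdsWithin_iff] at h1
      filter_upwards [h1] with q hq hqS
      by_cases he : q = p
      · subst he
        rw [Heis.inv_mul', hd.self, mul_zero, sub_self, zero_sub, norm_neg]
        have : Lt 0 = 0 := hLtc 0
        rw [this, norm_zero]
      · have hpos : 0 < d p q :=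
          lt_of_le_of_ne (hd.nonneg_s17 _ _) fun h0 => he ((hd.eq_iff p q).1 h0.symm).symm
        have := hq ⟨hqS, he⟩
        rw [div_lt_iff₀ hpos] at this
        rw [htu q hqS, htu p hp]
        exact this.le
    refine locally_uniform_of_pointwise hd _ L T C
      (fun lam hl x y => equi_lip hd p tu C hC lam hl x y) fun x hx => ?_
    rw [← hLtL x hx]
    exact forward_pointwise hmn hd hp hU hpU hf hg hSU hP hli Lt hLt hLtc tu C hC hdiff x
      ((hTiff x).1 hx)
  · intro hall
    obtain ⟨C0, hC0⟩ := hu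
    obtain ⟨tu, htu, C, hC⟩ := exists_lipschitz_extension d hd.self hd.symm hd.triangle S u C0 hC0
    have hconv := hall tu htu ⟨C, hC⟩
    -- the horizontal part of the tangent
    let W : Submodule ℝ ((Fin n → ℝ) × (Fin n → ℝ)) :=
      { carrier := {v | ((v.1, v.2, 0) : Heis n) ∈ T}
        zero_mem' := hTc 0
        add_mem' := by
          intro v w hv hw
          have hv : ((v.1, v.2, 0) : Heis n) ∈ T := hv
          have hw : ((w.1, w.2, 0) : Heis n) ∈ T := hw
          change (((v + w).1, (v + w).2, 0) : Heis n) ∈ T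
          rw [hTiff] at hv hw ⊢
          intro i
          have := hdot_mul (g p i) (v.1, v.2, 0) (w.1, w.2, 0)
          rw [hv, hw, add_zero] at this
          exact this
        smul_mem' := by
          intro c v hv
          have hv : ((v.1, v.2, 0) : Heis n) ∈ T := hv
          change (((c • v).1, (c • v).2, 0) : Heis n) ∈ T
          rw [hTiff] at hv ⊢
          intro i
          have := hdot_dil (g p i) c (v.1, v.2, 0)
          rw [hv, mul_zero] at this
          exact this }
    have hW : ∀ v : W, ((v.1.1, v.1.2, 0) : Heis n) ∈ T := fun v => v.2
    have hladd : ∀ v w : W, L ((v + w).1.1, (v + w).1.2, 0) = L (v.1.1, v.1.2, 0) + L (w.1.1, w.1.2, 0) := by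
      intro v w
      rw [← hLadd _ (hW v) _ (hW w)]
      have hm : Heis.mul ((v.1.1, v.1.2, 0) : Heis n) (w.1.1, w.1.2, 0) ∈ T := by
        rw [hTiff]
        intro i
        rw [hdot_mul, (hTiff _).1 (hW v), (hTiff _).1 (hW w), add_zero]
      rw [(hLproj _ hm).2]
      rfl
    have hlpos : ∀ (c : ℝ) (v : W), 0 < c → L ((c • v).1.1, (c • v).1.2, 0) = c • L (v.1.1, v.1.2, 0) := by
      intro c v hc
      rw [← hLhom c hc _ (hW v)]
      congr 1
      refine Prod.ext ?_ (Prod.ext ?_ ?_) <;> simp [Heis.dil]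
    let l : W →ₗ[ℝ] (Fin ℓ → ℝ) :=
      { toFun := fun v => L (v.1.1, v.1.2, 0)
        map_add' := hladd
        map_smul' := by
          intro c v
          change L ((c • v).1.1, (c • v).1.2, 0) = c • L (v.1.1, v.1.2, 0)
          rcases lt_trichotomy c 0 with h | h | h
          · have h1 := hladd (c • v) ((-c) • v)
            rw [← add_smul, add_neg_cancel, zero_smul, hlpos (-c) v (by linarith)] at h1
            have h2 : L (((0 : W)).1.1, ((0 : W)).1.2, 0) = 0 := hL0
            rw [h2, neg_smul] at h1
            exact (add_neg_eq_zero.1 h1.symm)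
          · subst h
            rw [zero_smul, zero_smul]
            exact hL0
          · exact hlpos c v h }
    obtain ⟨ext, hext⟩ := l.exists_extend
    have hextc : Continuous ext := ext.continuous_of_finiteDimensional
    let Lt : Heis n → Fin ℓ → ℝ := fun w => ext (w.1, w.2.1)
    have hLtL : ∀ w ∈ T, Lt w = L w := by
      intro w hw
      obtain ⟨h1, h2⟩ := hLproj w hw
      rw [h2]
      exact LinearMap.congr_fun hext (⟨(w.1, w.2.1), h1⟩ : W)
    have hLtdil : ∀ (c : ℝ) w, Lt (Heis.dil c w) = c • Lt w := by
      intro c w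
      simp only [Lt]
      rw [← map_smul]
      rfl
    have hLtcont : Continuous Lt := hextc.comp (by fun_prop)
    refine ⟨Lt, ?_, hLtL, ?_⟩
    · intro a b
      simp only [Lt]
      rw [← map_add]
      rfl
    rw [hd.dnhds_eq]
    refine tendsto_of_subseq_tendsto fun ns hns => ?_
    rw [tendsto_nhdsWithin_iff] at hns
    obtain ⟨hnp, hnS⟩ := hns
    obtain ⟨N, hN⟩ := eventually_atTop.1 hnS
    have hdpos : ∀ k, N ≤ k → 0 < d p (ns k) := by
      intro k hk
      refine lt_of_le_of_ne (hd.nonneg_s17 _ _) fun h0 => (hN k hk).2 ?_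
      exact ((hd.eq_iff p _).1 h0.symm).symm
    have hunit : ∀ k, Heis.dil (d p (ns (k + N)))⁻¹ (Heis.mul (Heis.inv p) (ns (k + N))) ∈
        {w : Heis n | d 0 w = 1} := by
      intro k
      have hk := hdpos (k + N) (Nat.le_add_left _ _)
      change d 0 _ = 1
      rw [hd.N_dil _ (inv_pos.2 hk), ← hd.eq_N, inv_mul_cancel₀ hk.ne']
    obtain ⟨z, -, φ, hφ, hzlim⟩ := hd.isCompact_unit.tendsto_subseq hunit
    set q : ℕ → Heis n := fun j => ns (φ j + N) with hq
    have hqpos : ∀ j, 0 < d p (q j) := fun j => hdpos _ (Nat.le_add_left _ _)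
    have hqS : ∀ j, q j ∈ S := fun j => (hN _ (Nat.le_add_left _ _)).1
    have hidx : Tendsto (fun j => φ j + N) atTop atTop :=
      tendsto_atTop_mono (fun j => Nat.le_add_right _ _) hφ.tendsto_atTop
    have hqp : Tendsto q atTop (𝓝 p) := hnp.comp hidx
    set lam : ℕ → ℝ := fun j => (d p (q j))⁻¹ with hlam
    have hlpos' : ∀ j, 0 < lam j := fun j => inv_pos.2 (hqpos j)
    have hlamT : Tendsto lam atTop atTop := by
      refine tendsto_inv_nhdsGT_zero.comp (tendsto_nhdsWithin_iff.2 ⟨(hd.tendsto_d p).comp hqp, ?_⟩)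
      exact Eventually.of_forall hqpos
    set zj : ℕ → Heis n := fun j => Heis.dil (lam j) (Heis.mul (Heis.inv p) (q j)) with hzj
    have hzjlim : Tendsto zj atTop (𝓝 z) := hzlim
    have hzT : z ∈ T := hT.2 lam zj z hlamT (fun j => ⟨q j, hqS j, rfl⟩) hzjlim
    have hpt : Tendsto (fun j => lam j • (tu (Heis.mul p (Heis.dil (lam j)⁻¹ z)) - tu p)) atTop (𝓝 (L z)) :=
      (hconv.tendsto_at hzT).comp hlamT
    have hdiff : Tendsto (fun j => lam j • (tu (q j) - tu p)
        - lam j • (tu (Heis.mul p (Heis.dil (lam j)⁻¹ z)) - tu p)) atTop (𝓝 0) := by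
      have h1 : Tendsto (fun j => C * d z (zj j)) atTop (𝓝 0) := by
        simpa using ((hd.tendsto_d z).comp hzjlim).const_mul C
      rw [tendsto_zero_iff_norm_tendsto_zero]
      refine squeeze_zero (fun _ => norm_nonneg _) (fun j => ?_) h1
      have h2 := equi_lip hd p tu C hC (lam j) (hlpos' j) (zj j) z
      simp only [hzj] at h2
      rw [Heis.dil_dil, inv_mul_cancel₀ (hlpos' j).ne', Heis.dil_one, Heis.mul_inv_cancel', hd.symm] at h2
      exact h2
    have hA : Tendsto (fun j => lam j • (tu (q j) - tu p)) atTop (𝓝 (L z)) := by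
      have := hdiff.add hpt
      simpa using this
    have hB : Tendsto (fun j => Lt (zj j)) atTop (𝓝 (L z)) := by
      rw [← hLtL z hzT]
      exact (hLtcont.tendsto z).comp hzjlim
    have hAB : Tendsto (fun j => ‖lam j • (tu (q j) - tu p) - Lt (zj j)‖) atTop (𝓝 0) := by
      have := (hA.sub hB).norm
      rwa [sub_self, norm_zero] at this
    refine ⟨fun j => φ j + N, hAB.congr fun j => ?_⟩
    simp only [hzj]
    rw [hLtdil, ← smul_sub, norm_smul, Real.norm_eq_abs, abs_of_pos (hlpos' j), htu _ (hqS j), htu p hp,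
      div_eq_inv_mul]
end
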